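/- Let X_free be a compact, path-connected subset of ℝ² equal to a finite union of convex polygons, fix an anchor x⋆ ∈ X_free, a tether length ζ ≥ 0, and points x_s, x₁, …, x_N ∈ X_free. Let ς_s be an optimal homotopic path in X_free from x⋆ to x_s with c(ς_s) ≤ ζ, and for i = 1,…,N let ς*_i be an optimal homotopic path from x⋆ to x_i with c(ς*_i) ≤ ζ. Set ς*_0 := ς_s, ς*_{N+1} := ς_s, x_0 := x_s, x_{N+1} := x_s. For i = 1,…,N+1 let σ_i be an optimal homotopic path in X_free from x_{i−1} to x_i with σ_i ≃_p ς̄*_{i−1} * ς*_i, and define γ := σ_1 * σ_2 * … * σ_{N+1}. Then γ is a solution of the tethered multi-goal visiting (TMV) problem: (1) γ is a loop at x_s that visits x₁,…,x_N in order; (2) for every t ∈ [0,1], m[ς_s * γ_{[0,t]}] ≤ ζ; (3) ς_s * γ ≃_p ς_s. -/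

import Mathlib

noncomputable section

/-- Points of the plane. -/
abbrev E2 : Type := EuclideanSpace ℝ (Fin 2)

namespace THPP

lemma subIcc_mem (s t₁ t₂ : unitInterval) :
    (1 - s.1) * t₁.1 + s.1 * t₂.1 ∈ Set.Icc (0 : ℝ) 1 := by
  have hs0 : (0:ℝ) ≤ s.1 := s.2.1
  have hs1 : s.1 ≤ 1 := s.2.2
  have ha0 : (0:ℝ) ≤ t₁.1 := t₁.2.1
  have ha1 : t₁.1 ≤ 1 := t₁.2.2
  have hb0 : (0:ℝ) ≤ t₂.1 := t₂.2.1
  have hb1 : t₂.1 ≤ 1 := t₂.2.2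
  constructor
  · have h1 := mul_nonneg (by linarith : (0:ℝ) ≤ 1 - s.1) ha0
    have h2 := mul_nonneg hs0 hb0
    linarith
  · have h1 := mul_nonneg (by linarith : (0:ℝ) ≤ 1 - s.1) (by linarith : (0:ℝ) ≤ 1 - t₁.1)
    have h2 := mul_nonneg hs0 (by linarith : (0:ℝ) ≤ 1 - t₂.1)
    nlinarith

/-- The subpath `σ_{[t₁,t₂]} : s ↦ σ ((1-s)·t₁ + s·t₂)`. -/
def subpath {Y : Type*} [TopologicalSpace Y] {a b : Y} (σ : Path a b) (t₁ t₂ : unitInterval) :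
    Path (σ t₁) (σ t₂) where
  toFun s := σ ⟨(1 - s.1) * t₁.1 + s.1 * t₂.1, subIcc_mem s t₁ t₂⟩
  continuous_toFun := σ.continuous.comp (Continuous.subtype_mk (by fun_prop) _)
  source' := by
    exact congrArg (fun u => σ u) (Subtype.ext (by simp))
  target' := by
    exact congrArg (fun u => σ u) (Subtype.ext (by simp))

/-- The subpath `σ_{[0,t]}`, as a path from the start point of `σ` to `σ t`. -/
def subpath0 {Y : Type*} [TopologicalSpace Y] {a b : Y} (σ : Path a b) (t : unitInterval) :
    Path a (σ t) :=
  (subpath σ 0 t).cast σ.source.symm rfl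

/-- The straight-line path `t ↦ (1-t)·x₀ + t·x₁`, as a path in `X` given that the
segment `[x₀, x₁]` is contained in `X`. -/
def linePath {X : Set E2} {x₀ x₁ : E2} (h₀ : x₀ ∈ X) (h₁ : x₁ ∈ X)
    (hseg : segment ℝ x₀ x₁ ⊆ X) : Path (⟨x₀, h₀⟩ : X) ⟨x₁, h₁⟩ where
  toFun t := ⟨(1 - t.1) • x₀ + t.1 • x₁,
    hseg (by rw [segment_eq_image]; exact ⟨t.1, t.2, rfl⟩)⟩
  continuous_toFun := Continuous.subtype_mk (by fun_prop) _
  source' := Subtype.ext (by simp)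
  target' := Subtype.ext (by simp)

/-- The cost (arc length) of a path in a subset of the plane: the total variation of the
underlying map `[0,1] → ℝ²`. -/
def cost {X : Set E2} {a b : X} (σ : Path a b) : ENNReal :=
  eVariationOn (fun t => (σ t : E2)) Set.univ

/-- A path is an optimal homotopic path if it has minimal cost within its
path-homotopy class (homotopies staying in `X`). -/
def IsOptimal {X : Set E2} {a b : X} (σ : Path a b) : Prop :=
  ∀ σ' : Path a b, σ.Homotopic σ' → cost σ ≤ cost σ'

/-- `m[σ]`: the infimal cost of the path-homotopy class of `σ`. -/
def mCost {X : Set E2} {a b : X} (σ : Path a b) : ENNReal :=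
  ⨅ σ' : {σ' : Path a b // σ.Homotopic σ'}, cost σ'.1

/-- Concatenation `σ₀ * σ₁ * ⋯ * σ_{n-1}` of a chain of paths. -/
def chain {Y : Type*} [TopologicalSpace Y] (x : ℕ → Y)
    (σ : ∀ i : ℕ, Path (x i) (x (i + 1))) : ∀ n : ℕ, Path (x 0) (x n)
  | 0 => Path.refl (x 0)
  | n + 1 => (chain x σ n).trans (σ n)

section
open Set Metric

lemma polytope_cone (S : Finset E2) (x : E2) (hx : x ∈ convexHull ℝ (S : Set E2)) :
    ∃ ρ > 0, ∀ (v : E2) (t : ℝ), x + v ∈ convexHull ℝ (S : Set E2) → 0 ≤ t → ‖t • v‖ < ρ →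
      x + t • v ∈ convexHull ℝ (S : Set E2) := by
  classical
  have h1 : ∀ T ∈ S.powerset, ∃ r > 0, x ∉ convexHull ℝ (T : Set E2) →
      ∀ z ∈ convexHull ℝ (T : Set E2), r ≤ dist x z := by
    intro T _
    by_cases h : x ∈ convexHull ℝ (T : Set E2)
    · exact ⟨1, one_pos, fun h' => absurd h h'⟩
    · have hc : IsClosed (convexHull ℝ (T : Set E2)) := (T.finite_toSet.isCompact_convexHull (𝕜 := ℝ)).isClosed
      obtain ⟨r, hr, hb⟩ := Metric.isOpen_iff.1 hc.isOpen_compl x h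
      refine ⟨r, hr, fun _ z hz => ?_⟩
      by_contra hlt
      push Not at hlt
      exact hb (by rw [mem_ball, dist_comm]; exact hlt) hz
  choose! f hf0 hf using h1
  have h2 : ∃ ρ > 0, ∀ T ∈ S.powerset, ρ ≤ f T := by
    refine ⟨S.powerset.inf' ⟨∅, by simp⟩ f, ?_, fun T hT => Finset.inf'_le _ hT⟩
    exact (Finset.lt_inf'_iff _).2 hf0
  obtain ⟨ρ, hρ, hρf⟩ := h2
  refine ⟨ρ, hρ, fun v t hv ht htv => ?_⟩
  by_cases hv0 : v = 0
  · simpa [hv0] using hx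
  have hvn : 0 < ‖v‖ := norm_pos_iff.2 hv0
  have hcomp : IsCompact (convexHull ℝ (S : Set E2)) := S.finite_toSet.isCompact_convexHull (𝕜 := ℝ)
  have hK : IsCompact {s : ℝ | 0 ≤ s ∧ x + s • v ∈ convexHull ℝ (S : Set E2)} := by
    obtain ⟨R, hR⟩ := hcomp.isBounded.subset_closedBall x
    apply Metric.isCompact_of_isClosed_isBounded
    · exact isClosed_Ici.inter (hcomp.isClosed.preimage (by fun_prop : Continuous fun s : ℝ => x + s • v))
    · apply (Metric.isBounded_Icc (0:ℝ) (R / ‖v‖)).subset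
      rintro s ⟨hs, hs'⟩
      refine ⟨hs, ?_⟩
      have := hR hs'
      rw [mem_closedBall, dist_eq_norm, add_sub_cancel_left, norm_smul, Real.norm_of_nonneg hs] at this
      rwa [le_div_iff₀ hvn]
  obtain ⟨t0, ⟨ht0, ht0m⟩, hmax⟩ := hK.exists_isMaxOn ⟨1, by simp, by simpa using hv⟩ continuousOn_id
  have h1t : (1:ℝ) ≤ t0 := hmax (show (1:ℝ) ∈ _ from ⟨by simp, by simpa using hv⟩)
  obtain ⟨w, hw0, hw1, hwz⟩ := Finset.mem_convexHull'.1 ht0m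
  set T := S.filter (fun y => w y ≠ 0) with hT
  have hTS : T ⊆ S := Finset.filter_subset _ _
  have hzT : x + t0 • v ∈ convexHull ℝ (T : Set E2) := by
    refine Finset.mem_convexHull'.2 ⟨w, fun y hy => hw0 y (hTS hy), ?_, ?_⟩
    · rw [hT, Finset.sum_filter_ne_zero, hw1]
    · rw [← hwz, hT, Finset.sum_filter]
      refine Finset.sum_congr rfl fun y _ => ?_
      split_ifs with h
      · rfl
      · push Not at h
        simp [h]
  have hxT : x ∉ convexHull ℝ (T : Set E2) := by
    intro hxT
    obtain ⟨d, hd0, hd1, hdx⟩ := Finset.mem_convexHull'.1 hxT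
    have hTne : T.Nonempty := by
      by_contra hne
      rw [Finset.not_nonempty_iff_eq_empty] at hne
      rw [hne] at hd1
      simp at hd1
    set ε := T.inf' hTne w with hε
    have hεpos : 0 < ε := by
      rw [hε, Finset.lt_inf'_iff]
      intro y hy
      exact lt_of_le_of_ne (hw0 y (hTS hy)) (Ne.symm (Finset.mem_filter.1 hy).2)
    have hd' : ∀ y ∈ T, d y ≤ 1 := fun y hy => by
      rw [← hd1]; exact Finset.single_le_sum hd0 hy
    have hmem : x + ((1 + ε) * t0) • v ∈ convexHull ℝ (S : Set E2) := by
      apply convexHull_mono (Finset.coe_subset.2 hTS)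
      obtain ⟨w', hw0', hw1', hwz'⟩ : ∃ w' : E2 → ℝ, (∀ y ∈ T, ε ≤ w' y) ∧ ∑ y ∈ T, w' y = 1 ∧
          ∑ y ∈ T, w' y • y = x + t0 • v := by
        refine ⟨w, fun y hy => Finset.inf'_le _ hy, ?_, ?_⟩
        · rw [hT, Finset.sum_filter_ne_zero, hw1]
        · rw [← hwz, hT, Finset.sum_filter]
          refine Finset.sum_congr rfl fun y _ => ?_
          split_ifs with h
          · rfl
          · push Not at h
            simp [h]
      refine Finset.mem_convexHull'.2 ⟨fun y => (1 + ε) * w' y - ε * d y, ?_, ?_, ?_⟩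
      · intro y hy
        have a1 := hw0' y hy
        have a2 := hd' y hy
        have a3 := hd0 y hy
        nlinarith [mul_nonneg hεpos.le (sub_nonneg.2 a2), mul_nonneg hεpos.le (hεpos.le.trans a1)]
      · rw [Finset.sum_sub_distrib, ← Finset.mul_sum, ← Finset.mul_sum, hw1', hd1]; ring
      · simp only [sub_smul, mul_smul]
        rw [Finset.sum_sub_distrib, ← Finset.smul_sum, ← Finset.smul_sum, hwz', hdx]
        module
    have : (1 + ε) * t0 ≤ t0 := hmax (show (1 + ε) * t0 ∈ _ from ⟨by positivity, hmem⟩)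
    nlinarith
  have hdist := hf T (Finset.mem_powerset.2 hTS) hxT _ hzT
  have hρT := hρf T (Finset.mem_powerset.2 hTS)
  rw [dist_eq_norm, sub_add_cancel_left, norm_neg, norm_smul, Real.norm_of_nonneg ht0] at hdist
  rw [norm_smul, Real.norm_of_nonneg ht] at htv
  have htt : t < t0 := by
    by_contra hh
    push Not at hh
    nlinarith
  have hseg := (convex_convexHull ℝ (S : Set E2)) hx ht0m
    (a := 1 - t / t0) (b := t / t0) (by
      have : t / t0 ≤ 1 := by rw [div_le_one (by linarith)]; exact htt.le
      linarith) (by positivity) (by ring)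
  convert! hseg using 1
  have : t0 ≠ 0 := by positivity
  rw [smul_add, smul_smul, div_mul_cancel₀ _ this]
  module

/-- local conicity -/
def ConeAt (X : Set E2) (x : E2) (ρ : ℝ) : Prop :=
  ∀ (v : E2) (t : ℝ), x + v ∈ X → 0 ≤ t → ‖v‖ < ρ → ‖t • v‖ < ρ → x + t • v ∈ X

lemma exists_coneAt {X : Set E2}
    (hpoly : ∃ (n : ℕ) (P : Fin n → Finset E2), X = ⋃ i, convexHull ℝ (↑(P i) : Set E2))
    (x : E2) : ∃ ρ > 0, ConeAt X x ρ := by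
  obtain ⟨n, P, hP⟩ := hpoly
  have h1 : ∀ i, ∃ r > 0, ∀ (v : E2) (t : ℝ), x + v ∈ convexHull ℝ (P i : Set E2) → 0 ≤ t →
      ‖v‖ < r → ‖t • v‖ < r → x + t • v ∈ convexHull ℝ (P i : Set E2) := by
    intro i
    by_cases h : x ∈ convexHull ℝ (P i : Set E2)
    · obtain ⟨ρ, h0, h1⟩ := polytope_cone (P i) x h
      exact ⟨ρ, h0, fun v t a b _ d => h1 v t a b d⟩
    · have hc : IsClosed (convexHull ℝ (P i : Set E2)) :=
        ((P i).finite_toSet.isCompact_convexHull (𝕜 := ℝ)).isClosed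
      obtain ⟨r, hr, hb⟩ := Metric.isOpen_iff.1 hc.isOpen_compl x h
      refine ⟨r, hr, fun v t a _ c _ => ?_⟩
      exact absurd a (hb (by simpa [dist_eq_norm] using c))
  choose f hf0 hf using h1
  have h2 : ∃ ρ > 0, ∀ i, ρ ≤ f i := by
    refine ⟨(insert 1 (Finset.univ.image f)).inf' ⟨1, by simp⟩ id, ?_, fun i => Finset.inf'_le id (by simp)⟩
    refine (Finset.lt_inf'_iff _).2 ?_
    intro y hy
    simp only [Finset.mem_insert, Finset.mem_image] at hy
    rcases hy with rfl | ⟨i, _, rfl⟩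
    · simp
    · exact hf0 i
  obtain ⟨ρ, hρ, hρf⟩ := h2
  refine ⟨ρ, hρ, fun v t hv ht h3 h4 => ?_⟩
  rw [hP] at hv ⊢
  obtain ⟨i, hi⟩ := mem_iUnion.1 hv
  exact mem_iUnion.2 ⟨i, hf i v t hi ht (h3.trans_le (hρf i)) (h4.trans_le (hρf i))⟩

end

section
open Set Metric

/-- cone at the origin -/
def Cone0 (C : Set E2) (ρ : ℝ) : Prop :=
  0 ∈ C ∧ ∀ (v : E2) (t : ℝ), v ∈ C → 0 ≤ t → ‖v‖ < ρ → ‖t • v‖ < ρ → t • v ∈ C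

/-- planar determinant -/
def pdet (y z : E2) : ℝ := y 0 * z 1 - y 1 * z 0

lemma pdet_cont (y : E2) : Continuous (pdet y) := by
  unfold pdet
  fun_prop

lemma pdet_comb (y a b : E2) (s t : ℝ) : pdet y (s • a + t • b) = s * pdet y a + t * pdet y b := by
  simp [pdet]; ring

lemma pdet_self (y : E2) : pdet y y = 0 := by simp [pdet]; ring

lemma pdet_zero {y z : E2} (hy : y ≠ 0) (h : pdet y z = 0) : ∃ c : ℝ, z = c • y := by
  have hq : y 0 ^ 2 + y 1 ^ 2 ≠ 0 := by
    intro hq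
    apply hy
    have h0 : y 0 = 0 := by nlinarith [sq_nonneg (y 0), sq_nonneg (y 1)]
    have h1 : y 1 = 0 := by nlinarith [sq_nonneg (y 0), sq_nonneg (y 1)]
    ext i; fin_cases i <;> simp [h0, h1]
  refine ⟨(y 0 * z 0 + y 1 * z 1) / (y 0 ^ 2 + y 1 ^ 2), ?_⟩
  unfold pdet at h
  ext i; fin_cases i
  · simp; field_simp; linear_combination (- y 1) * h
  · simp; field_simp; linear_combination (y 0) * h

lemma cross_pt {C : Set E2} {ρ : ℝ} (hC : Cone0 C ρ) {y z : E2} (hy : y ∉ C) (hyρ : ‖y‖ < ρ)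
    (hz : z ∈ C) (hzρ : ‖z‖ < ρ) (h : pdet y z = 0) : ∃ l : ℝ, 0 ≤ l ∧ z = - (l • y) := by
  have hy0 : y ≠ 0 := by rintro rfl; exact hy hC.1
  obtain ⟨c, hc⟩ := pdet_zero hy0 h
  refine ⟨-c, ?_, by rw [hc]; module⟩
  by_contra hlt
  have hc0 : 0 < c := by linarith
  have e : y = c⁻¹ • z := by rw [hc, smul_smul, inv_mul_cancel₀ hc0.ne', one_smul]
  apply hy
  rw [e]
  exact hC.2 z c⁻¹ hz (by positivity) hzρ (by rw [← e]; exact hyρ)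

lemma cross_len (a b : E2) {s l : ℝ} (hs0 : 0 ≤ s) (hs1 : s ≤ 1) (hl : 0 ≤ l) :
    ‖a‖ + ‖b‖ ≤ ‖a + l • ((1 - s) • a + s • b)‖ + ‖b + l • ((1 - s) • a + s • b)‖ := by
  have h1 : ‖(1 + l * (1 - s)) • a‖ ≤ ‖a + l • ((1 - s) • a + s • b)‖ + ‖(l * s) • b‖ := by
    have := norm_sub_le (a + l • ((1 - s) • a + s • b)) ((l * s) • b)
    rwa [show a + l • ((1 - s) • a + s • b) - (l * s) • b = (1 + l * (1 - s)) • a by module] at this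
  have h2 : ‖(1 + l * s) • b‖ ≤ ‖b + l • ((1 - s) • a + s • b)‖ + ‖(l * (1 - s)) • a‖ := by
    have := norm_sub_le (b + l • ((1 - s) • a + s • b)) ((l * (1 - s)) • a)
    rwa [show b + l • ((1 - s) • a + s • b) - (l * (1 - s)) • a = (1 + l * s) • b by module] at this
  have hs : 0 ≤ 1 - s := by linarith
  rw [norm_smul, norm_smul, Real.norm_of_nonneg (by positivity), Real.norm_of_nonneg (by positivity)] at h1 h2
  linarith


lemma nonneg_aux (m c : E2) : 0 ≤ (inner ℝ (m) (‖c‖ • m + ‖m‖ • c) : ℝ) := by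
  rw [inner_add_right, inner_smul_right, inner_smul_right, real_inner_self_eq_norm_sq]
  have := neg_le_of_abs_le (abs_real_inner_le_norm m c)
  nlinarith [norm_nonneg m, norm_nonneg c]

lemma vis_half {m a c : E2} {s θ l : ℝ} (hs0 : 0 ≤ s) (hs1 : s ≤ 1) (hl : 0 ≤ l) (h0 : 0 ≤ θ)
    (h1 : θ ≤ 1) (h : (1 - θ) • m + θ • a = - (l • ((1 - s) • m + s • c))) :
    (inner ℝ (a) (‖c‖ • m + ‖m‖ • c) : ℝ) ≤ 0 := by
  have hm := nonneg_aux m c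
  have hc := nonneg_aux c m
  rw [add_comm (‖m‖ • c)] at hc
  rcases h0.eq_or_lt with h0 | h0
  · subst h0
    have e : (1 + l * (1 - s)) • m = - ((l * s) • c) := by
      have : m = - (l • ((1 - s) • m + s • c)) := by simpa using h
      have e2 : m + l • ((1 - s) • m + s • c) = 0 := by
        nth_rewrite 1 [this]; simp
      rw [eq_neg_iff_add_eq_zero, ← e2]; module
    have hs : 0 ≤ 1 - s := by linarith
    have en := congrArg norm e
    rw [norm_neg, norm_smul, norm_smul, Real.norm_of_nonneg (by positivity),
      Real.norm_of_nonneg (by positivity)] at en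
    have hk : (0:ℝ) < 1 + l * (1 - s) := by positivity
    have : (1 + l * (1 - s)) • (‖c‖ • m + ‖m‖ • c) = 0 := by
      rw [smul_add, smul_comm, e, smul_smul _ ‖m‖, en]; module
    rw [(smul_eq_zero.1 this).resolve_left hk.ne', inner_zero_right]
  · set n := ‖c‖ • m + ‖m‖ • c
    have := congrArg (fun v => (inner ℝ (v) (n) : ℝ)) h
    simp only [inner_add_left, inner_smul_left, inner_neg_left] at this
    simp at this
    have hs : 0 ≤ 1 - s := by linarith
    have p1 := mul_nonneg (sub_nonneg.2 h1) hm
    have p2 := mul_nonneg hl (add_nonneg (mul_nonneg hs hm) (mul_nonneg hs0 hc))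
    have : θ * (inner ℝ (a) (n) : ℝ) ≤ 0 := by linarith
    by_contra hh
    push Not at hh
    nlinarith

lemma exists_zero_seg (y a b : E2) (h : pdet y a * pdet y b ≤ 0) :
    ∃ θ : ℝ, 0 ≤ θ ∧ θ ≤ 1 ∧ pdet y ((1 - θ) • a + θ • b) = 0 := by
  have hc : Continuous fun θ : ℝ => pdet y ((1 - θ) • a + θ • b) :=
    (pdet_cont y).comp (by fun_prop)
  have e0 : pdet y ((1 - (0:ℝ)) • a + (0:ℝ) • b) = pdet y a := by simp
  have e1 : pdet y ((1 - (1:ℝ)) • a + (1:ℝ) • b) = pdet y b := by simp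
  rcases le_total (pdet y a) 0 with ha | ha
  · by_cases hb : 0 ≤ pdet y b
    · obtain ⟨θ, hθ, h'⟩ := intermediate_value_Icc (zero_le_one (α := ℝ)) hc.continuousOn
        (show (0:ℝ) ∈ Icc _ _ by rw [e0, e1]; exact ⟨ha, hb⟩)
      exact ⟨θ, hθ.1, hθ.2, h'⟩
    · have : pdet y a = 0 := by nlinarith
      exact ⟨0, le_rfl, zero_le_one, by rw [e0, this]⟩
  · by_cases hb : pdet y b ≤ 0
    · obtain ⟨θ, hθ, h'⟩ := intermediate_value_Icc' (zero_le_one (α := ℝ)) hc.continuousOn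
        (show (0:ℝ) ∈ Icc _ _ by rw [e0, e1]; exact ⟨hb, ha⟩)
      exact ⟨θ, hθ.1, hθ.2, h'⟩
    · have : pdet y a = 0 := by nlinarith
      exact ⟨0, le_rfl, zero_le_one, by rw [e0, this]⟩

lemma comb_mem_segment (a b : E2) {θ : ℝ} (h0 : 0 ≤ θ) (h1 : θ ≤ 1) :
    (1 - θ) • a + θ • b ∈ segment ℝ a b := ⟨1 - θ, θ, by linarith, h0, by ring, rfl⟩

lemma exists_comb_of_not_vis {C : Set E2} {a b : E2} (h : ¬ segment ℝ a b ⊆ C) :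
    ∃ s : ℝ, 0 ≤ s ∧ s ≤ 1 ∧ (1 - s) • a + s • b ∉ C := by
  rw [not_subset] at h
  obtain ⟨y, ⟨p, q, hp, hq, hpq, rfl⟩, hy⟩ := h
  refine ⟨q, hq, by linarith, ?_⟩
  rwa [show 1 - q = p by linarith]

lemma norm_lt_of_mem_segment {a b z : E2} {ρ : ℝ} (ha : ‖a‖ < ρ) (hb : ‖b‖ < ρ)
    (hz : z ∈ segment ℝ a b) : ‖z‖ < ρ := by
  have := (convex_ball (0:E2) ρ).segment_subset (by simpa using ha) (by simpa using hb) hz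
  simpa using this

lemma visibility {C : Set E2} {ρ : ℝ} (hC : Cone0 C ρ) {m a c : E2} (hm : ‖m‖ < ρ) (ha : ‖a‖ < ρ)
    (hc : ‖c‖ < ρ) (hma : segment ℝ m a ⊆ C) (hca : segment ℝ c a ⊆ C)
    (hmc : ¬ segment ℝ m c ⊆ C) : (inner ℝ (a) (‖c‖ • m + ‖m‖ • c) : ℝ) ≤ 0 := by
  obtain ⟨s, hs0, hs1, hy⟩ := exists_comb_of_not_vis hmc
  set y := (1 - s) • m + s • c with hydef
  have hyρ : ‖y‖ < ρ := norm_lt_of_mem_segment hm hc (comb_mem_segment m c hs0 hs1)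
  have hg : (1 - s) * pdet y m + s * pdet y c = 0 := by rw [← pdet_comb, ← hydef, pdet_self]
  by_cases h1 : pdet y m * pdet y a ≤ 0
  · obtain ⟨θ, h0, h1, hz⟩ := exists_zero_seg y m a h1
    have hzs := comb_mem_segment m a h0 h1
    obtain ⟨l, hl, e⟩ := cross_pt hC hy hyρ (hma hzs) (norm_lt_of_mem_segment hm ha hzs) hz
    exact vis_half hs0 hs1 hl h0 h1 e
  · have h2 : pdet y c * pdet y a ≤ 0 := by
      by_contra h2
      push Not at h1 h2
      have : 0 < ((1 - s) * pdet y m + s * pdet y c) * pdet y a := by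
        rcases hs0.eq_or_lt with h | h
        · rw [← h]; linarith
        · have := mul_pos h h2
          have := mul_nonneg (sub_nonneg.2 hs1) h1.le
          nlinarith
      rw [hg] at this
      simp at this
    obtain ⟨θ, h0, h1, hz⟩ := exists_zero_seg y c a h2
    have hzs := comb_mem_segment c a h0 h1
    obtain ⟨l, hl, e⟩ := cross_pt hC hy hyρ (hca hzs) (norm_lt_of_mem_segment hc ha hzs) hz
    rw [add_comm]
    apply vis_half (s := 1 - s) (by linarith) (by linarith) hl h0 h1
    rw [e, hydef]; module

lemma vis_star {C : Set E2} {ρ : ℝ} (hC : Cone0 C ρ) {a c : E2} (ha : ‖a‖ < ρ)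
    (hc : ‖c‖ < ρ) (hca : segment ℝ a c ⊆ C) {t : ℝ} (h0 : 0 ≤ t) (h1 : t ≤ 1) :
    segment ℝ (t • a) c ⊆ C := by
  rintro z ⟨p, q, hp, hq, hpq, rfl⟩
  set k := p * t + q with hk
  have hk0 : 0 ≤ k := by positivity
  rcases hk0.eq_or_lt with h | h
  · have h3 : q = 0 := by nlinarith [mul_nonneg hp h0]
    have h4 : p * t = 0 := by nlinarith
    rw [smul_smul, h3, h4]; simpa using hC.1
  · have hk1 : k ≤ 1 := by nlinarith
    have e : p • t • a + q • c = k • ((p * t / k) • a + (q / k) • c) := by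
      rw [smul_add, smul_smul, smul_smul, smul_smul, mul_div_cancel₀ _ h.ne', mul_div_cancel₀ _ h.ne']
    have hs : (p * t / k) • a + (q / k) • c ∈ segment ℝ a c :=
      ⟨_, _, by positivity, by positivity, by rw [← add_div]; exact div_self h.ne', rfl⟩
    have hn := norm_lt_of_mem_segment ha hc hs
    rw [e]
    refine hC.2 _ k (hca hs) h.le hn ?_
    rw [norm_smul, Real.norm_of_nonneg h.le]
    nlinarith [norm_nonneg ((p * t / k) • a + (q / k) • c)]

lemma vis_zero {C : Set E2} {ρ : ℝ} (hC : Cone0 C ρ) {c : E2} (hcC : c ∈ C)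
    (hc : ‖c‖ < ρ) : segment ℝ 0 c ⊆ C := by
  have := vis_star hC hc hc (by simpa [segment_same] using hcC) (t := 0) le_rfl zero_le_one
  simpa using this

open Classical in
/-- local intrinsic distance -/
def dC (C : Set E2) (a b : E2) : ℝ := if segment ℝ a b ⊆ C then ‖a - b‖ else ‖a‖ + ‖b‖

lemma dC_symm (C : Set E2) (a b : E2) : dC C a b = dC C b a := by
  unfold dC
  rw [segment_symm, norm_sub_rev, add_comm]

lemma dC_le (C : Set E2) (a b : E2) : dC C a b ≤ ‖a‖ + ‖b‖ := by
  unfold dC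
  split_ifs
  · exact norm_sub_le _ _
  · exact le_rfl

lemma dC_nonneg (C : Set E2) (a b : E2) : 0 ≤ dC C a b := by
  unfold dC
  split_ifs <;> positivity

lemma nsq (a b : E2) : ‖a - b‖ ^ 2 = ‖a‖ ^ 2 - 2 * (inner ℝ (a) (b) : ℝ) + ‖b‖ ^ 2 := norm_sub_sq_real a b

lemma local_cn_vis {C : Set E2} {ρ : ℝ} (hC : Cone0 C ρ) {a b c : E2}
    (ha : ‖a‖ < ρ) (hb : ‖b‖ < ρ) (hc : ‖c‖ < ρ) (hab : segment ℝ a b ⊆ C) :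
    dC C ((1/2 : ℝ) • (a + b)) c ^ 2 ≤ dC C a c ^ 2 / 2 + dC C b c ^ 2 / 2 - dC C a b ^ 2 / 4 := by
  set m := (1/2 : ℝ) • (a + b) with hm
  have hms : m ∈ segment ℝ a b := ⟨1/2, 1/2, by norm_num, by norm_num, by norm_num, by rw [hm]; module⟩
  have hmρ := norm_lt_of_mem_segment ha hb hms
  have hma : segment ℝ m a ⊆ C := ((convex_segment a b).segment_subset hms (left_mem_segment ℝ a b)).trans hab
  have hmb : segment ℝ m b ⊆ C := ((convex_segment a b).segment_subset hms (right_mem_segment ℝ a b)).trans hab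
  have emm : ∀ w : E2, 2 * (inner ℝ (m) (w) : ℝ) = (inner ℝ (a) (w) : ℝ) + (inner ℝ (b) (w) : ℝ) := by
    intro w; rw [hm, inner_smul_left, inner_add_left]; simp
  have emn : ‖m‖ ^ 2 = ‖a‖ ^ 2 / 2 + ‖b‖ ^ 2 / 2 - ‖a - b‖ ^ 2 / 4 := by
    have h1 := emm m
    rw [real_inner_self_eq_norm_sq, real_inner_comm m a, real_inner_comm m b] at h1
    have h2 := emm a
    have h3 := emm b
    rw [real_inner_self_eq_norm_sq] at h2 h3
    rw [nsq, real_inner_comm a b] at *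
    linarith
  have emc : ‖m - c‖ ^ 2 = ‖a - c‖ ^ 2 / 2 + ‖b - c‖ ^ 2 / 2 - ‖a - b‖ ^ 2 / 4 := by
    rw [nsq m c, nsq a c, nsq b c, emn]
    linarith [emm c]
  have edab : dC C a b = ‖a - b‖ := if_pos hab
  have na := norm_nonneg a
  have nb := norm_nonneg b
  have nc := norm_nonneg c
  have nm := norm_nonneg m
  have hmle := dC_le C m c
  have hm0 := dC_nonneg C m c
  have hmsq : dC C m c ^ 2 ≤ (‖m‖ + ‖c‖) ^ 2 := by gcongr
  have hmab : 2 * ‖m‖ ≤ ‖a‖ + ‖b‖ := by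
    have := norm_add_le a b
    rw [hm, norm_smul]; norm_num; linarith
  clear_value m
  have half : ∀ a b : E2, ‖a‖ < ρ → (∀ w : E2, 2 * (inner ℝ (m) (w) : ℝ) = (inner ℝ (a) (w) : ℝ) + (inner ℝ (b) (w) : ℝ)) →
      segment ℝ m a ⊆ C → segment ℝ a c ⊆ C → ¬ segment ℝ m c ⊆ C →
      2 * ‖m‖ * ‖c‖ ≤ - (inner ℝ (a) (c) : ℝ) + ‖b‖ * ‖c‖ := by
    intro a b ha he hma hac hmc
    have hv := visibility hC hmρ ha hc hma (by rwa [segment_symm]) hmc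
    rw [inner_add_right, inner_smul_right, inner_smul_right] at hv
    have hbm := real_inner_le_norm b m
    have h1 := he m
    rw [real_inner_self_eq_norm_sq] at h1
    rcases nm.eq_or_lt with h | h
    · have : m = 0 := norm_eq_zero.1 h.symm
      have h2 := he c
      rw [this, inner_zero_left] at h2
      have := neg_le_of_abs_le (abs_real_inner_le_norm b c)
      have := real_inner_le_norm b c
      rw [← h]; linarith
    · have : ‖m‖ * (2 * ‖m‖ * ‖c‖) ≤ ‖m‖ * (- (inner ℝ (a) (c) : ℝ) + ‖b‖ * ‖c‖) := by
        have : ‖c‖ * (2 * ‖m‖ ^ 2) ≤ ‖c‖ * ((inner ℝ (a) (m) : ℝ) + ‖b‖ * ‖m‖) := by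
          gcongr; linarith
        nlinarith
      exact le_of_mul_le_mul_left this h
  rw [edab]
  by_cases h1 : segment ℝ a c ⊆ C <;> by_cases h2 : segment ℝ b c ⊆ C
  · have e1 : dC C a c = ‖a - c‖ := if_pos h1
    have e2 : dC C b c = ‖b - c‖ := if_pos h2
    rw [e1, e2]
    by_cases h3 : segment ℝ m c ⊆ C
    · rw [show dC C m c = ‖m - c‖ from if_pos h3, emc]
    · have v1 := visibility hC hmρ ha hc hma (by rwa [segment_symm]) h3
      have v2 := visibility hC hmρ hb hc hmb (by rwa [segment_symm]) h3
      have v3 := emm (‖c‖ • m + ‖m‖ • c)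
      have v4 : (inner ℝ (m) (‖c‖ • m + ‖m‖ • c) : ℝ) ≤ 0 := by linarith
      rw [inner_add_right, inner_smul_right, inner_smul_right, real_inner_self_eq_norm_sq] at v4
      have v5 : ‖m‖ * ‖c‖ + (inner ℝ (m) (c) : ℝ) ≤ 0 := by
        rcases nm.eq_or_lt with h | h
        · have : m = 0 := norm_eq_zero.1 h.symm
          rw [this]; simp
        · by_contra hh
          push Not at hh
          nlinarith
      rw [← emc, nsq]
      nlinarith
  · have e1 : dC C a c = ‖a - c‖ := if_pos h1
    have e2 : dC C b c = ‖b‖ + ‖c‖ := if_neg h2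
    rw [e1, e2]
    by_cases h3 : segment ℝ m c ⊆ C
    · rw [show dC C m c = ‖m - c‖ from if_pos h3, emc]
      have : ‖b - c‖ ≤ ‖b‖ + ‖c‖ := norm_sub_le _ _
      gcongr
    · have := half a b ha emm hma h1 h3
      rw [nsq a c]
      nlinarith
  · have e1 : dC C a c = ‖a‖ + ‖c‖ := if_neg h1
    have e2 : dC C b c = ‖b - c‖ := if_pos h2
    rw [e1, e2]
    by_cases h3 : segment ℝ m c ⊆ C
    · rw [show dC C m c = ‖m - c‖ from if_pos h3, emc]
      have : ‖a - c‖ ≤ ‖a‖ + ‖c‖ := norm_sub_le _ _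
      gcongr
    · have := half b a hb (fun w => by rw [emm, add_comm]) hmb h2 h3
      rw [nsq b c]
      nlinarith
  · have e1 : dC C a c = ‖a‖ + ‖c‖ := if_neg h1
    have e2 : dC C b c = ‖b‖ + ‖c‖ := if_neg h2
    rw [e1, e2]
    nlinarith

lemma local_cn_nvis {C : Set E2} {ρ : ℝ} (hC : Cone0 C ρ) {a b c : E2}
    (ha : ‖a‖ < ρ) (hb : ‖b‖ < ρ) (hc : ‖c‖ < ρ) (hab : ¬ segment ℝ a b ⊆ C) (hle : ‖b‖ ≤ ‖a‖)
    (ha0 : 0 < ‖a‖) :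
    dC C (((‖a‖ - ‖b‖) / (2 * ‖a‖)) • a) c ^ 2 ≤
      dC C a c ^ 2 / 2 + dC C b c ^ 2 / 2 - dC C a b ^ 2 / 4 := by
  set t := (‖a‖ - ‖b‖) / (2 * ‖a‖) with ht
  set m := t • a with hm
  have nb := norm_nonneg b
  have nc := norm_nonneg c
  have ht0 : 0 ≤ t := div_nonneg (by linarith) (by linarith)
  have hta : 2 * (t * ‖a‖) = ‖a‖ - ‖b‖ := by rw [ht]; field_simp
  have ht1 : t ≤ 1 := by rw [ht, div_le_one (by linarith)]; linarith
  have nm : ‖m‖ = t * ‖a‖ := by rw [hm, norm_smul, Real.norm_of_nonneg ht0]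
  have edab : dC C a b = ‖a‖ + ‖b‖ := if_neg hab
  have hmle := dC_le C m c
  have hm0 := dC_nonneg C m c
  have hmsq : dC C m c ^ 2 ≤ (‖m‖ + ‖c‖) ^ 2 := by gcongr
  have hT : (t * ‖a‖) ^ 2 = (‖a‖ - ‖b‖) ^ 2 / 4 := by
    have : t * ‖a‖ = (‖a‖ - ‖b‖) / 2 := by linarith
    rw [this]; ring
  have hac := real_inner_le_norm a c
  have hbc := real_inner_le_norm b c
  rw [edab]
  by_cases h1 : segment ℝ a c ⊆ C
  · have e1 : dC C a c = ‖a - c‖ := if_pos h1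
    have hmc : segment ℝ m c ⊆ C := vis_star hC ha hc h1 ht0 ht1
    have e3 : dC C m c ^ 2 = (t * ‖a‖) ^ 2 - 2 * (t * (inner ℝ (a) (c) : ℝ)) + ‖c‖ ^ 2 := by
      rw [show dC C m c = ‖m - c‖ from if_pos hmc, nsq, nm, hm, inner_smul_left]; simp
    have hta' : ‖a‖ * (2 * t) = ‖a‖ - ‖b‖ := by linarith
    rw [e3, hT, e1, nsq]
    by_cases h2 : segment ℝ b c ⊆ C
    · have e2 : dC C b c = ‖b - c‖ := if_pos h2
      have v := visibility hC ha hc hb h1 h2 hab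
      rw [inner_add_right, inner_smul_right, inner_smul_right, real_inner_comm, real_inner_comm b c] at v
      have hv : (1 - 2 * t) * (inner ℝ (a) (c) : ℝ) + (inner ℝ (b) (c) : ℝ) ≤ 0 := by
        by_contra hh
        push Not at hh
        have := mul_pos ha0 hh
        have e : ‖a‖ * ((1 - 2 * t) * (inner ℝ (a) (c) : ℝ) + (inner ℝ (b) (c) : ℝ)) = (‖a‖ - ‖a‖ * (2 * t)) * (inner ℝ (a) (c) : ℝ) + ‖a‖ * (inner ℝ (b) (c) : ℝ) := by ring
        rw [e, hta'] at this
        linarith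
      rw [e2, nsq]
      nlinarith
    · have e2 : dC C b c = ‖b‖ + ‖c‖ := if_neg h2
      have hv : (1 - 2 * t) * (inner ℝ (a) (c) : ℝ) ≤ ‖b‖ * ‖c‖ := by
        have h3 : 0 ≤ 1 - 2 * t := by
          have : ‖a‖ * (1 - 2 * t) = ‖b‖ := by linarith
          by_contra hh
          push Not at hh
          nlinarith
        have := mul_le_mul_of_nonneg_left hac h3
        have e : (1 - 2 * t) * (‖a‖ * ‖c‖) = (‖a‖ - ‖a‖ * (2 * t)) * ‖c‖ := by ring
        rw [e, hta'] at this
        linarith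
      rw [e2]
      nlinarith
  · have e1 : dC C a c = ‖a‖ + ‖c‖ := if_neg h1
    rw [e1]
    rw [nm] at hmsq
    have e5 : (t * ‖a‖ + ‖c‖) ^ 2 = (‖a‖ - ‖b‖) ^ 2 / 4 + (‖a‖ - ‖b‖) * ‖c‖ + ‖c‖ ^ 2 := by
      rw [add_sq, hT]; linear_combination ‖c‖ * hta
    rw [e5] at hmsq
    by_cases h2 : segment ℝ b c ⊆ C
    · have e2 : dC C b c = ‖b - c‖ := if_pos h2
      rw [e2, nsq]
      nlinarith
    · have e2 : dC C b c = ‖b‖ + ‖c‖ := if_neg h2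
      rw [e2]
      nlinarith [mul_nonneg nb nc]

lemma local_cn {C : Set E2} {ρ : ℝ} (hC : Cone0 C ρ) {a b : E2} (haC : a ∈ C) (hbC : b ∈ C)
    (ha : ‖a‖ < ρ) (hb : ‖b‖ < ρ) :
    ∃ m ∈ C, ‖m‖ ≤ max ‖a‖ ‖b‖ ∧ dC C a m = dC C a b / 2 ∧ dC C b m = dC C a b / 2 ∧
      ∀ c ∈ C, ‖c‖ < ρ →
        dC C m c ^ 2 ≤ dC C a c ^ 2 / 2 + dC C b c ^ 2 / 2 - dC C a b ^ 2 / 4 := by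
  have main : ∀ a b : E2, a ∈ C → b ∈ C → ‖a‖ < ρ → ‖b‖ < ρ → ¬ segment ℝ a b ⊆ C → ‖b‖ ≤ ‖a‖ →
    ∃ m ∈ C, ‖m‖ ≤ ‖a‖ ∧ dC C a m = dC C a b / 2 ∧ dC C b m = dC C a b / 2 ∧
      ∀ c ∈ C, ‖c‖ < ρ →
        dC C m c ^ 2 ≤ dC C a c ^ 2 / 2 + dC C b c ^ 2 / 2 - dC C a b ^ 2 / 4 := by
    intro a b haC hbC ha hb hab hle
    have ha0 : 0 < ‖a‖ := by
      rw [norm_pos_iff]; rintro rfl; exact hab (vis_zero hC hbC hb)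
    have hcn : ∀ c : E2, ‖c‖ < ρ → _ := fun c hc => local_cn_nvis hC ha hb hc hab hle ha0
    set t := (‖a‖ - ‖b‖) / (2 * ‖a‖) with ht
    have nb := norm_nonneg b
    have ht0 : 0 ≤ t := div_nonneg (by linarith) (by linarith)
    have hta : 2 * (t * ‖a‖) = ‖a‖ - ‖b‖ := by rw [ht]; field_simp
    have ht1 : t ≤ 1 := by rw [ht, div_le_one (by linarith)]; linarith
    have nm : ‖t • a‖ = t * ‖a‖ := by rw [norm_smul, Real.norm_of_nonneg ht0]
    have edab : dC C a b = ‖a‖ + ‖b‖ := if_neg hab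
    have haa : segment ℝ a a ⊆ C := by simpa [segment_same] using haC
    have hmle : ‖t • a‖ ≤ ‖a‖ := by rw [nm]; nlinarith
    have hmC : t • a ∈ C := hC.2 a t haC ht0 ha (by linarith)
    have hma : segment ℝ (t • a) a ⊆ C := vis_star hC ha ha haa ht0 ht1
    have hmb : ‖b‖ < ‖a‖ → ¬ segment ℝ (t • a) b ⊆ C := by
      intro hlt h
      obtain ⟨s, hs0, hs1, hy⟩ := exists_comb_of_not_vis hab
      have htp : 0 < t := div_pos (by linarith) (by linarith)
      apply hy
      -- the point y = (1-s)a + s b; scaled version lies on the segment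
      set k := (1 - s) / t + s with hk
      have hs1' : 0 ≤ 1 - s := by linarith
      have hk0 : 0 < k := by
        have h3 : (1 - s) ≤ (1 - s) / t := by
          rw [le_div_iff₀ htp]; nlinarith
        rcases hs0.eq_or_lt with h4 | h4
        · rw [← h4] at h3 hk; rw [hk]; linarith
        · rw [hk]; positivity
      have hz : ((1 - s) / t / k) • (t • a) + (s / k) • b ∈ segment ℝ (t • a) b :=
        ⟨_, _, by positivity, by positivity, by rw [← add_div]; exact div_self hk0.ne', rfl⟩
      have e : (1 - s) • a + s • b = k • (((1 - s) / t / k) • (t • a) + (s / k) • b) := by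
        rw [smul_add, smul_smul, smul_smul, smul_smul]
        congr 2 <;> field_simp
      have hyρ := norm_lt_of_mem_segment ha hb (comb_mem_segment a b hs0 hs1)
      rw [e]
      exact hC.2 _ k (h hz) hk0.le (norm_lt_of_mem_segment (by linarith) hb hz) (by rw [← e]; exact hyρ)
    refine ⟨t • a, hmC, hmle, ?_, ?_, fun c _ hc => hcn c hc⟩
    · rw [dC_symm, show dC C (t • a) a = ‖t • a - a‖ from if_pos hma, edab,
        show t • a - a = (t - 1) • a by module, norm_smul, Real.norm_eq_abs, abs_of_nonpos (by linarith)]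
      linarith
    · rcases hle.eq_or_lt with h | h
      · have : t = 0 := by rw [ht, h]; simp
        rw [this, zero_smul, dC_symm, show dC C 0 b = ‖0 - b‖ from if_pos (vis_zero hC hbC hb), edab, zero_sub,
          norm_neg]
        linarith
      · rw [dC_symm, show dC C (t • a) b = _ from if_neg (hmb h), nm, edab]
        linarith
  by_cases hab : segment ℝ a b ⊆ C
  · set m := (1/2 : ℝ) • (a + b) with hm
    have hms : m ∈ segment ℝ a b := ⟨1/2, 1/2, by norm_num, by norm_num, by norm_num, by rw [hm]; module⟩
    have hma : segment ℝ a m ⊆ C := ((convex_segment a b).segment_subset (left_mem_segment ℝ a b) hms).trans hab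
    have hmb : segment ℝ b m ⊆ C := ((convex_segment a b).segment_subset (right_mem_segment ℝ a b) hms).trans hab
    have edab : dC C a b = ‖a - b‖ := if_pos hab
    refine ⟨m, hab hms, ?_, ?_, ?_, fun c _ hc => local_cn_vis hC ha hb hc hab⟩
    · have h1 := norm_add_le a b
      have h2 := le_max_left ‖a‖ ‖b‖
      have h3 := le_max_right ‖a‖ ‖b‖
      rw [hm, norm_smul, show ‖(1/2:ℝ)‖ = 1/2 by norm_num]; linarith
    · rw [edab, show dC C a m = ‖a - m‖ from if_pos hma, show a - m = (1/2 : ℝ) • (a - b) by rw [hm]; module,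
        norm_smul]; norm_num; ring
    · rw [edab, show dC C b m = ‖b - m‖ from if_pos hmb, show b - m = (-1/2 : ℝ) • (a - b) by rw [hm]; module,
        norm_smul]; norm_num; ring
  · rcases le_total ‖b‖ ‖a‖ with h | h
    · obtain ⟨m, h1, h2, h3⟩ := main a b haC hbC ha hb hab h
      exact ⟨m, h1, h2.trans (le_max_left _ _), h3⟩
    · obtain ⟨m, h1, h2, h3, h4, h5⟩ := main b a hbC haC hb ha (by rwa [segment_symm]) h
      refine ⟨m, h1, h2.trans (le_max_right _ _), by rw [h4, dC_symm], by rw [h3, dC_symm], fun c hc hc' => ?_⟩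
      have := h5 c hc hc'
      rw [dC_symm C a b]
      linarith

end

section
open Set Metric
open scoped ENNReal unitInterval

lemma cost_cast {X : Set E2} {a b a' b' : X} (γ : Path a b) (h : a' = a) (h' : b' = b) :
    cost (γ.cast h h') = cost γ := rfl

lemma cost_symm_le {X : Set E2} {a b : X} (γ : Path a b) : cost γ.symm ≤ cost γ := by
  unfold cost
  exact eVariationOn.comp_le_of_antitoneOn (fun t => (γ t : E2)) (t := univ) (s := univ) unitInterval.symm
    (fun x _ y _ h => by simpa using h) (fun _ _ => mem_univ _)

/-- halving and doubling maps -/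
def dbl (t : I) : I := ⟨min 1 (2 * t.1), le_min zero_le_one (by have := t.2.1; positivity), min_le_left _ _⟩
def dbl' (t : I) : I := ⟨max 0 (2 * t.1 - 1), le_max_left _ _, max_le zero_le_one (by have := t.2.2; linarith)⟩
def hlf : I := ⟨1/2, by norm_num, by norm_num⟩

lemma dbl_mono : Monotone dbl := fun a b h => Subtype.mk_le_mk.2 (by
  have : a.1 ≤ b.1 := h
  exact min_le_min le_rfl (by linarith))
lemma dbl'_mono : Monotone dbl' := fun a b h => Subtype.mk_le_mk.2 (by
  have : a.1 ≤ b.1 := h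
  exact max_le_max le_rfl (by linarith))

lemma trans_left {Y : Type*} [TopologicalSpace Y] {a b c : Y} (P : Path a b) (Q : Path b c) {t : I}
    (h : t ≤ hlf) : P.trans Q t = P (dbl t) := by
  have h' : t.1 ≤ 1/2 := h
  rw [Path.trans_apply, dif_pos h']
  congr 1
  apply Subtype.ext
  simp only [dbl]
  rw [min_eq_right (by linarith)]

lemma trans_right {Y : Type*} [TopologicalSpace Y] {a b c : Y} (P : Path a b) (Q : Path b c) {t : I}
    (h : hlf ≤ t) : P.trans Q t = Q (dbl' t) := by
  have h' : 1/2 ≤ t.1 := h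
  rcases h'.eq_or_lt with h1 | h1
  · have e : t = hlf := Subtype.ext h1.symm
    subst e
    rw [Path.trans_apply, dif_pos (by norm_num [hlf])]
    have e1 : (⟨2 * (hlf : I).1, by norm_num [hlf]⟩ : I) = 1 := Subtype.ext (by norm_num [hlf])
    have e2 : dbl' hlf = 0 := Subtype.ext (by norm_num [hlf, dbl'])
    rw [e2, Path.source]
    exact (congrArg P e1).trans P.target
  · rw [Path.trans_apply, dif_neg (by linarith)]
    congr 1
    apply Subtype.ext
    simp only [dbl']
    rw [max_eq_right (by linarith)]

lemma univ_eq_Icc : (univ : Set I) = Icc 0 1 := by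
  ext t; simp [unitInterval.nonneg', unitInterval.le_one']

lemma Icc_add {f : I → E2} {a b c : I} (h1 : a ≤ b) (h2 : b ≤ c) :
    eVariationOn f (Icc a b) + eVariationOn f (Icc b c) = eVariationOn f (Icc a c) := by
  simpa using eVariationOn.Icc_add_Icc f (s := univ) h1 h2 (mem_univ _)

lemma cost_split {X : Set E2} {a b : X} (γ : Path a b) (t : I) :
    cost γ = eVariationOn (fun t => (γ t : E2)) (Icc 0 t) + eVariationOn (fun t => (γ t : E2)) (Icc t 1) := by
  rw [Icc_add unitInterval.nonneg' unitInterval.le_one', cost, univ_eq_Icc]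

lemma cost_trans_le {X : Set E2} {a b c : X} (P : Path a b) (Q : Path b c) :
    cost (P.trans Q) ≤ cost P + cost Q := by
  rw [cost_split _ hlf]
  gcongr
  · rw [eVariationOn.congr (g := (fun t => (P t : E2)) ∘ dbl)]
    · exact eVariationOn.comp_le_of_monotoneOn _ _ (dbl_mono.monotoneOn _) (fun _ _ => mem_univ _)
    · intro t ht
      simp only [Function.comp]
      rw [trans_left P Q ht.2]
  · rw [eVariationOn.congr (g := (fun t => (Q t : E2)) ∘ dbl')]
    · exact eVariationOn.comp_le_of_monotoneOn _ _ (dbl'_mono.monotoneOn _) (fun _ _ => mem_univ _)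
    · intro t ht
      simp only [Function.comp]
      rw [trans_right P Q ht.1]

lemma edist_le_cost {X : Set E2} {a b : X} (γ : Path a b) (s t : I) :
    edist (γ s : E2) (γ t) ≤ cost γ := eVariationOn.edist_le _ (mem_univ s) (mem_univ t)

lemma edist_add_le_cost {X : Set E2} {a b : X} (γ : Path a b) (t : I) :
    edist (a : E2) (γ t) + edist (γ t : E2) b ≤ cost γ := by
  rw [cost_split γ t]
  gcongr
  · have := eVariationOn.edist_le (fun t => (γ t : E2)) (s := Icc 0 t) (x := 0) (y := t)
      ⟨le_rfl, unitInterval.nonneg'⟩ ⟨unitInterval.nonneg', le_rfl⟩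
    simpa using this
  · have := eVariationOn.edist_le (fun t => (γ t : E2)) (s := Icc t 1) (x := t) (y := 1)
      ⟨le_rfl, unitInterval.le_one'⟩ ⟨unitInterval.le_one', le_rfl⟩
    simpa using this

lemma cost_subpath_le {X : Set E2} {a b : X} (γ : Path a b) {s t : I} (h : s ≤ t) :
    cost (γ.subpath s t) ≤ eVariationOn (fun t => (γ t : E2)) (Icc s t) := by
  unfold cost
  refine eVariationOn.comp_le_of_monotoneOn (fun t => (γ t : E2)) (t := univ) (s := Icc s t)
    (fun u => Set.Icc.convexComb s t u) ?_ ?_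
  · intro u _ v _ huv
    have h1 : s.1 ≤ t.1 := h
    have h2 : u.1 ≤ v.1 := huv
    show (1 - u.1) * s.1 + u.1 * t.1 ≤ (1 - v.1) * s.1 + v.1 * t.1
    nlinarith
  · intro u _
    have := Path.range_subpathAux s t
    rw [uIcc_of_le h] at this
    rw [← this]; exact mem_range_self u

lemma cost_line_le {X : Set E2} {x₀ x₁ : E2} (h₀ : x₀ ∈ X) (h₁ : x₁ ∈ X)
    (hseg : segment ℝ x₀ x₁ ⊆ X) : cost (linePath h₀ h₁ hseg) ≤ ENNReal.ofReal ‖x₀ - x₁‖ := by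
  unfold cost
  have hL : LipschitzOnWith ‖x₀ - x₁‖₊ (fun t : ℝ => (1 - t) • x₀ + t • x₁) univ := by
    apply LipschitzOnWith.of_dist_le_mul
    intro s _ t _
    rw [dist_eq_norm, show ((1 - s) • x₀ + s • x₁) - ((1 - t) • x₀ + t • x₁) = (t - s) • (x₀ - x₁) by module,
      norm_smul, mul_comm, Real.dist_eq, abs_sub_comm, Real.norm_eq_abs, coe_nnnorm]
  have h1 := hL.comp_eVariationOn_le (g := fun t : I => (t : ℝ)) (s := univ) (fun _ _ => mem_univ _)
  have h2 : eVariationOn (fun t : I => (t : ℝ)) univ ≤ 1 := by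
    rw [univ_eq_Icc]
    have := MonotoneOn.eVariationOn_le (f := fun t : I => (t : ℝ)) (s := univ) (a := 0) (b := 1)
      (fun x _ y _ h => h) (mem_univ _) (mem_univ _)
    simpa using this
  refine h1.trans ?_
  calc _ ≤ (‖x₀ - x₁‖₊ : ℝ≥0∞) * 1 := by gcongr
    _ = _ := by rw [mul_one, ofReal_norm_eq_enorm]; rfl

/-- intrinsic distance -/
def iD {X : Set E2} (a b : X) : ℝ≥0∞ := ⨅ γ : Path a b, cost γ

lemma iD_le {X : Set E2} {a b : X} (γ : Path a b) : iD a b ≤ cost γ := iInf_le _ γ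

lemma iD_comm {X : Set E2} (a b : X) : iD a b = iD b a :=
  le_antisymm (le_iInf fun γ => (iD_le γ.symm).trans (cost_symm_le γ))
    (le_iInf fun γ => (iD_le γ.symm).trans (cost_symm_le γ))

lemma iD_triangle {X : Set E2} (a b c : X) : iD a c ≤ iD a b + iD b c := by
  unfold iD
  rw [ENNReal.iInf_add]
  refine le_iInf fun P => ?_
  rw [ENNReal.add_iInf]
  exact le_iInf fun Q => (iD_le (P.trans Q)).trans (cost_trans_le P Q)

lemma edist_le_iD {X : Set E2} (a b : X) : edist (a : E2) b ≤ iD a b :=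
  le_iInf fun γ => by simpa using edist_le_cost γ 0 1

/-- the translated set -/
def tr (X : Set E2) (x : E2) : Set E2 := {v | x + v ∈ X}

lemma cone0_tr {X : Set E2} {x : E2} {ρ : ℝ} (hx : x ∈ X) (h : ConeAt X x ρ) : Cone0 (tr X x) ρ :=
  ⟨by simpa [tr] using hx, fun v t hv ht h1 h2 => h v t hv ht h1 h2⟩

lemma seg_tr {X : Set E2} {x a b : E2} (h : segment ℝ (a - x) (b - x) ⊆ tr X x) : segment ℝ a b ⊆ X := by
  rintro z ⟨p, q, hp, hq, hpq, rfl⟩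
  have := h ⟨p, q, hp, hq, hpq, rfl⟩
  simp only [tr, mem_ofPred_eq] at this
  convert this using 1
  have : q = 1 - p := by linarith
  subst this
  module

lemma iD_center {X : Set E2} {x : X} {ρ : ℝ} (h : ConeAt X x ρ) (p : X) (hp : ‖(p : E2) - x‖ < ρ) :
    iD x p ≤ ENNReal.ofReal ‖(p : E2) - x‖ := by
  have hs : segment ℝ (x : E2) p ⊆ X := by
    apply seg_tr (x := x)
    rw [sub_self]
    exact vis_zero (cone0_tr x.2 h) (by simp [tr]) hp
  rw [norm_sub_rev]
  exact (iD_le _).trans (cost_line_le x.2 p.2 hs)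

lemma iD_local {X : Set E2} {x : X} {ρ : ℝ} (h : ConeAt X x ρ) (p q : X)
    (hp : ‖(p : E2) - x‖ < ρ / 2) (hq : ‖(q : E2) - x‖ < ρ / 2) :
    iD p q = ENNReal.ofReal (dC (tr X x) (p - x) (q - x)) := by
  have hC := cone0_tr x.2 h
  have hρ : 0 < ρ := by have := norm_nonneg ((p : E2) - x); linarith
  have hp' : ‖(p : E2) - x‖ < ρ := by linarith
  have hq' : ‖(q : E2) - x‖ < ρ := by linarith
  by_cases hv : segment ℝ ((p : E2) - x) (q - x) ⊆ tr X x
  · rw [dC, if_pos hv, sub_sub_sub_cancel_right]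
    apply le_antisymm
    · exact (iD_le _).trans (cost_line_le p.2 q.2 (seg_tr hv))
    · have := edist_le_iD p q
      rwa [edist_dist, dist_eq_norm] at this
  · rw [dC, if_neg hv]
    apply le_antisymm
    · refine (iD_triangle p x q).trans ?_
      rw [ENNReal.ofReal_add (norm_nonneg _) (norm_nonneg _), iD_comm p x]
      exact add_le_add (iD_center h p hp') (iD_center h q hq')
    · refine le_iInf fun γ => ?_
      have key : ∀ t : I, ‖(p : E2) - x‖ + ‖(q : E2) - x‖ ≤ ‖(p : E2) - γ t‖ + ‖(γ t : E2) - q‖ →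
          ENNReal.ofReal (‖(p : E2) - x‖ + ‖(q : E2) - x‖) ≤ cost γ := by
        intro t ht
        refine le_trans ?_ (edist_add_le_cost γ t)
        rw [edist_dist, edist_dist, dist_eq_norm, dist_eq_norm,
          ← ENNReal.ofReal_add (norm_nonneg _) (norm_nonneg _)]
        exact ENNReal.ofReal_le_ofReal ht
      by_cases hb : ∃ t, ρ ≤ ‖(γ t : E2) - x‖
      · obtain ⟨t, ht⟩ := hb
        apply key t
        have h1 := norm_sub_le_norm_sub_add_norm_sub (γ t : E2) p x
        have h2 := norm_sub_le_norm_sub_add_norm_sub (γ t : E2) q x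
        rw [norm_sub_rev (γ t : E2) p] at h1
        linarith
      · push Not at hb
        obtain ⟨s, hs0, hs1, hy⟩ := exists_comb_of_not_vis hv
        set y := (1 - s) • ((p : E2) - x) + s • ((q : E2) - x) with hydef
        have hyρ : ‖y‖ < ρ := norm_lt_of_mem_segment hp' hq' (comb_mem_segment _ _ hs0 hs1)
        have hg : (1 - s) * pdet y (p - x) + s * pdet y (q - x) = 0 := by
          rw [← pdet_comb, ← hydef, pdet_self]
        have hcont : Continuous fun t : I => pdet y ((γ t : E2) - x) :=
          (pdet_cont y).comp ((continuous_subtype_val.comp γ.continuous).sub continuous_const)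
        have hz : ∃ t : I, pdet y ((γ t : E2) - x) = 0 := by
          have e0 : pdet y ((γ 0 : E2) - x) = pdet y (p - x) := by simp
          have e1 : pdet y ((γ 1 : E2) - x) = pdet y (q - x) := by simp
          apply mem_range_of_exists_le_of_exists_ge hcont
          · by_contra hh
            push Not at hh
            have h0 := hh 0
            have h1 := hh 1
            rw [e0] at h0
            rw [e1] at h1
            rcases hs0.eq_or_lt with h | h
            · rw [← h] at hg; linarith
            · nlinarith [mul_nonneg (sub_nonneg.2 hs1) h0.le, mul_pos h h1]
          · by_contra hh
            push Not at hh
            have h0 := hh 0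
            have h1 := hh 1
            rw [e0] at h0
            rw [e1] at h1
            rcases hs0.eq_or_lt with h | h
            · rw [← h] at hg; linarith
            · nlinarith [mul_nonneg (sub_nonneg.2 hs1) (neg_nonneg.2 h0.le), mul_pos h (neg_pos.2 h1)]
        obtain ⟨t, ht⟩ := hz
        obtain ⟨l, hl, e⟩ := cross_pt hC hy hyρ (z := (γ t : E2) - x) (by simp [tr]) (hb t) ht
        apply key t
        have := cross_len ((p : E2) - x) (q - x) hs0 hs1 hl
        rw [← hydef] at this
        refine this.trans (le_of_eq ?_)
        have e' : l • y = x - (γ t : E2) := by rw [← neg_eq_iff_eq_neg] at e; rw [← e]; abel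
        rw [e', norm_sub_rev (γ t : E2) q]
        congr 2 <;> abel

end

section
open Set Metric
open scoped ENNReal unitInterval

structure Good (X : Set E2) : Prop where
  comp : IsCompact X
  cone : ∀ x, ∃ ρ > 0, ConeAt X x ρ
  fin : ∀ a b : X, iD a b ≠ ⊤

lemma good_of {X : Set E2} (hcomp : IsCompact X) (hpc : IsPathConnected X)
    (hcone : ∀ x, ∃ ρ > 0, ConeAt X x ρ) : Good X := by
  refine ⟨hcomp, hcone, fun a => ?_⟩
  haveI : PathConnectedSpace X := isPathConnected_iff_pathConnectedSpace.1 hpc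
  have near : ∀ b : X, ∃ ρ > 0, ∀ c : X, dist c b < ρ → iD b c < ⊤ := by
    intro b
    obtain ⟨ρ, h0, h⟩ := hcone b
    refine ⟨ρ, h0, fun c hc => (iD_center h c ?_).trans_lt ENNReal.ofReal_lt_top⟩
    rwa [← dist_eq_norm]
  have hS : IsClopen {b : X | iD a b < ⊤} := by
    constructor
    · rw [← isOpen_compl_iff, Metric.isOpen_iff]
      intro b hb
      obtain ⟨ρ, h0, h⟩ := near b
      refine ⟨ρ, h0, fun c hc hc2 => hb ?_⟩
      have h1 := h c hc
      rw [iD_comm] at h1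
      exact (iD_triangle a c b).trans_lt (ENNReal.add_lt_top.2 ⟨hc2, h1⟩)
    · rw [Metric.isOpen_iff]
      intro b hb
      obtain ⟨ρ, h0, h⟩ := near b
      exact ⟨ρ, h0, fun c hc => (iD_triangle a b c).trans_lt (ENNReal.add_lt_top.2 ⟨hb, h c hc⟩)⟩
  have := hS.eq_univ ⟨a, lt_of_le_of_lt (iD_le (Path.refl a)) (by
    have : cost (Path.refl a) = 0 := eVariationOn.constant_on (by
      intro x hx y hy; obtain ⟨_, _, rfl⟩ := hx; obtain ⟨_, _, rfl⟩ := hy; rfl)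
    rw [this]; simp)⟩
  intro b
  have hb : b ∈ {b : X | iD a b < ⊤} := this ▸ mem_univ b
  exact ne_of_lt hb

lemma cost_refl {X : Set E2} (a : X) : cost (Path.refl a) = 0 := eVariationOn.constant_on (by
      intro x hx y hy; obtain ⟨_, _, rfl⟩ := hx; obtain ⟨_, _, rfl⟩ := hy; rfl)

/-- real intrinsic distance -/
def D {X : Set E2} (a b : X) : ℝ := (iD a b).toReal

variable {X : Set E2}

lemma D_nonneg (a b : X) : 0 ≤ D a b := ENNReal.toReal_nonneg
lemma D_comm (a b : X) : D a b = D b a := by rw [D, iD_comm]; rfl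
lemma D_self (a : X) : D a a = 0 := by
  have : iD a a = 0 := le_antisymm ((iD_le (Path.refl a)).trans (cost_refl a).le) zero_le
  simp [D, this]
lemma Good.ofReal_D (G : Good X) (a b : X) : ENNReal.ofReal (D a b) = iD a b :=
  ENNReal.ofReal_toReal (G.fin a b)
lemma Good.tri (G : Good X) (a b c : X) : D a c ≤ D a b + D b c := by
  unfold D
  rw [← ENNReal.toReal_add (G.fin _ _) (G.fin _ _)]
  exact ENNReal.toReal_mono (ENNReal.add_ne_top.2 ⟨G.fin _ _, G.fin _ _⟩) (iD_triangle a b c)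
lemma Good.dist_le (G : Good X) (a b : X) : dist a b ≤ D a b := by
  have := edist_le_iD a b
  rw [← G.ofReal_D, edist_dist] at this
  exact (ENNReal.ofReal_le_ofReal_iff (D_nonneg _ _)).1 this
lemma Good.eq_of (G : Good X) {a b : X} (h : D a b ≤ 0) : a = b :=
  dist_le_zero.1 ((G.dist_le a b).trans h)
lemma Good.D_le_cost (G : Good X) {a b : X} (γ : Path a b) : ENNReal.ofReal (D a b) ≤ cost γ := by
  rw [G.ofReal_D]; exact iD_le γ
lemma Good.exists_path (G : Good X) (a b : X) {ε : ℝ} (hε : 0 < ε) :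
    ∃ γ : Path a b, cost γ ≤ ENNReal.ofReal (D a b + ε) := by
  have : iD a b < ENNReal.ofReal (D a b + ε) := by
    rw [← G.ofReal_D]
    exact (ENNReal.ofReal_lt_ofReal_iff (by have := D_nonneg a b; linarith)).2 (by linarith)
  obtain ⟨γ, h⟩ := iInf_lt_iff.1 this
  exact ⟨γ, h.le⟩

lemma Good.lebesgue (G : Good X) (f : X → ℝ) (hf : ∀ x, 0 < f x) :
    ∃ r > 0, ∀ a : X, ∃ x : X, ∀ b : X, dist a b < r → ‖(b : E2) - x‖ < f x := by
  obtain ⟨r, hr, h⟩ := lebesgue_number_lemma_of_metric (s := X) (c := fun x : X => ball (x : E2) (f x)) G.comp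
    (fun x => isOpen_ball) (fun x hx => mem_iUnion.2 ⟨⟨x, hx⟩, mem_ball_self (hf _)⟩)
  refine ⟨r, hr, fun a => ?_⟩
  obtain ⟨x, hx⟩ := h a a.2
  refine ⟨x, fun b hb => ?_⟩
  have := hx (show (b : E2) ∈ ball (a : E2) r by rw [mem_ball, dist_comm]; exact hb)
  rwa [mem_ball, dist_eq_norm] at this

lemma Good.unif (G : Good X) {δ : ℝ} (hδ : 0 < δ) : ∃ η > 0, ∀ a b : X, dist a b < η → D a b < δ := by
  choose ρ h0 hρ using G.cone
  obtain ⟨r, hr, h⟩ := G.lebesgue (fun x => min (ρ x) (δ / 2)) (fun x => lt_min (h0 _) (by linarith))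
  refine ⟨r, hr, fun a b hab => ?_⟩
  obtain ⟨x, hx⟩ := h a
  have key : ∀ b : X, dist a b < r → D x b < δ / 2 := by
    intro b hb
    have h1 := hx b hb
    have h2 := iD_center (hρ x) b (h1.trans_le (min_le_left _ _))
    rw [← G.ofReal_D] at h2
    exact ((ENNReal.ofReal_le_ofReal_iff (norm_nonneg _)).1 h2).trans_lt (h1.trans_le (min_le_right _ _))
  have h1 := key a (by simpa using hr)
  have h2 := key b hab
  have := G.tri a x b
  rw [D_comm a x] at this
  linarith

lemma Good.cn (G : Good X) : ∃ r > 0, ∀ a b : X, D a b < r → ∃ m : X, D a m = D a b / 2 ∧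
    D b m = D a b / 2 ∧ ∀ c : X, D a c < r →
      D m c ^ 2 ≤ D a c ^ 2 / 2 + D b c ^ 2 / 2 - D a b ^ 2 / 4 := by
  choose ρ h0 hρ using G.cone
  obtain ⟨r, hr, h⟩ := G.lebesgue (fun x => ρ x / 2) (fun x => by have := h0 x; linarith)
  refine ⟨r, hr, fun a b hab => ?_⟩
  obtain ⟨x, hx⟩ := h a
  have loc : ∀ p q : X, ‖(p : E2) - x‖ < ρ x / 2 → ‖(q : E2) - x‖ < ρ x / 2 →
      D p q = dC (tr X x) (p - x) (q - x) := by
    intro p q hp hq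
    rw [D, iD_local (hρ x) p q hp hq, ENNReal.toReal_ofReal (dC_nonneg _ _ _)]
  have memt : ∀ p : X, (p : E2) - x ∈ tr X x := fun p => by simp [tr]
  have hr0 := h0 x
  have ha := hx a (by simpa using hr)
  have hb := hx b ((G.dist_le _ _).trans_lt hab)
  obtain ⟨m, hm, hm1, hm2, hm3, hm4⟩ := local_cn (cone0_tr x.2 (hρ x)) (memt a) (memt b) (by linarith) (by linarith)
  have hmX : (x : E2) + m ∈ X := hm
  set M : X := ⟨x + m, hmX⟩ with hM
  have eM : (M : E2) - x = m := by simp [hM]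
  have hMn : ‖(M : E2) - x‖ < ρ x / 2 := by
    rw [eM]; exact hm1.trans_lt (max_lt ha hb)
  refine ⟨M, ?_, ?_, ?_⟩
  · rw [loc a M ha hMn, loc a b ha hb, eM]; exact hm2
  · rw [loc b M hb hMn, loc a b ha hb, eM]; exact hm3
  · intro c hc
    have hcn := hx c ((G.dist_le _ _).trans_lt hc)
    rw [loc M c hMn hcn, loc a c ha hcn, loc b c hb hcn, loc a b ha hb, eM]
    exact hm4 _ (memt c) (by linarith)

lemma Good.homot (G : Good X) : ∃ r > 0, ∀ a b : X, ∀ γ γ' : Path a b,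
    (∀ t, dist a (γ t) < r) → (∀ t, dist a (γ' t) < r) → γ.Homotopic γ' := by
  choose ρ h0 hρ using G.cone
  obtain ⟨r, hr, h⟩ := G.lebesgue (fun x => ρ x) (fun x => h0 x)
  refine ⟨r, hr, fun a b γ γ' hγ hγ' => ?_⟩
  obtain ⟨x, hx⟩ := h a
  let B : Set E2 := X ∩ ball (x : E2) (ρ x)
  have hB : StarConvex ℝ (x : E2) B := by
    rw [starConvex_iff_segment_subset]
    intro y hy
    have hyn : ‖y - x‖ < ρ x := by have := hy.2; rwa [mem_ball, dist_eq_norm] at this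
    refine subset_inter ?_ ((convex_ball (x : E2) (ρ x)).segment_subset (mem_ball_self (h0 _)) hy.2)
    apply seg_tr (x := x)
    rw [sub_self]
    exact vis_zero (cone0_tr x.2 (hρ x)) (by simpa [tr] using hy.1) hyn
  haveI : ContractibleSpace B := hB.contractibleSpace ⟨x, x.2, mem_ball_self (h0 _)⟩
  have memB : ∀ p : X, dist a p < r → (p : E2) ∈ B := fun p hp =>
    ⟨p.2, by have := hx p hp; rwa [mem_ball, dist_eq_norm]⟩
  let inc : B → X := fun p => ⟨p.1, p.2.1⟩
  have hinc : Continuous inc := continuous_subtype_val.subtype_mk _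
  let lift : ∀ (γ : Path a b) (hγ : ∀ t, dist a (γ t) < r),
      Path (⟨a, memB a (by simpa using hr)⟩ : B) ⟨b, memB b (by simpa using hγ 1)⟩ := fun γ hγ =>
    { toFun := fun t => ⟨γ t, memB _ (hγ t)⟩
      continuous_toFun := (continuous_subtype_val.comp γ.continuous).subtype_mk _
      source' := by apply Subtype.ext; simp
      target' := by apply Subtype.ext; simp }
  have := (SimplyConnectedSpace.paths_homotopic (lift γ hγ) (lift γ' hγ')).map ⟨inc, hinc⟩
  exact this

end

section
open Set Metric
open scoped ENNReal unitInterval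
variable {X : Set E2}

def IsMid (a b m : X) : Prop := D a m = D a b / 2 ∧ D b m = D a b / 2

lemma IsMid.symm {a b m : X} (h : IsMid a b m) : IsMid b a m := by
  unfold IsMid at *; rw [D_comm b a]; exact ⟨h.2, h.1⟩

def CN (X : Set E2) (r : ℝ) : Prop := ∀ a b : X, D a b < r → ∃ m : X, IsMid a b m ∧ ∀ c : X, D a c < r →
      D m c ^ 2 ≤ D a c ^ 2 / 2 + D b c ^ 2 / 2 - D a b ^ 2 / 4

lemma Good.exists_cn (G : Good X) : ∃ r > 0, CN X r := by
  obtain ⟨r, hr, h⟩ := G.cn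
  refine ⟨r, hr, fun a b hab => ?_⟩
  obtain ⟨m, h1, h2, h3⟩ := h a b hab
  exact ⟨m, ⟨h1, h2⟩, h3⟩

lemma CN.of_mid {r : ℝ} (G : Good X) (h : CN X r) {a b m : X} (hab : D a b < r) (hm : IsMid a b m) :
    ∀ c : X, D a c < r → D m c ^ 2 ≤ D a c ^ 2 / 2 + D b c ^ 2 / 2 - D a b ^ 2 / 4 := by
  obtain ⟨m', h1, h2⟩ := h a b hab
  have h3 := h2 m (by rw [hm.1]; have := D_nonneg a b; linarith)
  rw [hm.1, hm.2] at h3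
  have h4 : D m' m ^ 2 ≤ 0 := by nlinarith
  have h5 : D m' m ≤ 0 := by nlinarith [D_nonneg m' m]
  have := G.eq_of h5
  rw [← this]; exact h2

lemma CN.bus {r : ℝ} (G : Good X) (h : CN X r) {a b b' m m' : X} (h1 : D a b < r) (h2 : D a b' < r)
    (hm : IsMid a b m) (hm' : IsMid a b' m') : D m m' ≤ D b b' / 2 := by
  have e1 := h.of_mid G h1 hm m' (by rw [hm'.1]; have := D_nonneg a b'; linarith)
  have e2 := h.of_mid G h2 hm' b h1
  rw [D_comm b' b] at e2
  rw [D_comm b m', hm'.1] at e1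
  have : D m m' ^ 2 ≤ (D b b' / 2) ^ 2 := by nlinarith
  exact le_of_sq_le_sq this (by have := D_nonneg b b'; linarith)
where le_of_sq_le_sq {x y : ℝ} (h : x ^ 2 ≤ y ^ 2) (hy : 0 ≤ y) : x ≤ y := by nlinarith

lemma CN.bus2 {r : ℝ} (G : Good X) (h : CN X r) {a b a' b' m m' : X} (h1 : D a b < r) (h2 : D a b' < r)
    (h3 : D a' b' < r) (hm : IsMid a b m) (hm' : IsMid a' b' m') :
    D m m' ≤ (D a a' + D b b') / 2 := by
  obtain ⟨n, hn, _⟩ := h a b' h2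
  have e1 := h.bus G h1 h2 hm hn
  have e2 := h.bus G (by rwa [D_comm]) (by rwa [D_comm]) hn.symm hm'.symm
  have := G.tri m n m'
  linarith

structure Grid (p : X) (q A B : ℕ → X) (n K : ℕ) (δ : ℝ) (z : ℕ → ℕ → X) : Prop where
  h : ∀ i j, D (z i j) (z i (j+1)) ≤ δ
  v : ∀ i j, D (z i j) (z (i+1) j) ≤ δ
  r0 : ∀ j, z 0 j = p
  rn : ∀ j, z n j = q j
  c0 : ∀ i, z i 0 = A i
  cK : ∀ i, z i K = B i

def VV (n : ℕ) (z : ℕ → ℕ → X) (j : ℕ) : ℝ := ∑ i ∈ Finset.range n, D (z i j) (z (i+1) j)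

lemma VV_nonneg (n : ℕ) (z : ℕ → ℕ → X) (j : ℕ) : 0 ≤ VV n z j :=
  Finset.sum_nonneg fun _ _ => D_nonneg _ _

lemma Grid.step (G : Good X) {r δ : ℝ} (hr : CN X r) (hδ : 3 * δ < r) {p : X} {q A B : ℕ → X} {n K : ℕ}
    (hq : ∀ j, j + 1 < K → IsMid (q j) (q (j+2)) (q (j+1)))
    {z : ℕ → ℕ → X} (g : Grid p q A B n K δ z) :
    ∃ z', Grid p q A B n K δ z' ∧ ∀ j, j + 1 < K → VV n z' (j+1) ≤ (VV n z j + VV n z (j+2)) / 2 := by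
  have hδ0 : 0 ≤ δ := (D_nonneg _ _).trans (g.h 0 0)
  have h2 : ∀ i j, D (z i j) (z i (j+2)) ≤ 2 * δ := fun i j => by
    have := G.tri (z i j) (z i (j+1)) (z i (j+2))
    have h1 := g.h i j
    have h2 := g.h i (j+1)
    linarith
  have h2' : ∀ i j, D (z i j) (z i (j+2)) < r := fun i j => by have := h2 i j; linarith
  have h3 : ∀ i j, D (z i j) (z i (j+3)) < r := fun i j => by
    have := G.tri (z i j) (z i (j+2)) (z i (j+3))
    have h1 := h2 i j
    have h2 := g.h i (j+2)
    linarith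
  have h4 : ∀ i j, D (z i j) (z (i+1) (j+2)) < r := fun i j => by
    have := G.tri (z i j) (z i (j+2)) (z (i+1) (j+2))
    have h1 := h2 i j
    have h2 := g.v i (j+2)
    linarith
  have hmid : ∀ i j, ∃ m, IsMid (z i j) (z i (j+2)) m := fun i j =>
    let ⟨m, hm, _⟩ := hr _ _ (h2' i j); ⟨m, hm⟩
  choose M hM using hmid
  have uniq : ∀ i j m, IsMid (z i j) (z i (j+2)) m → M i j = m := fun i j m hm => by
    apply G.eq_of
    have := hr.bus G (h2' i j) (h2' i j) (hM i j) hm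
    rwa [D_self, zero_div] at this
  let z' : ℕ → ℕ → X := fun i j => match j with
    | 0 => z i 0
    | j+1 => if j + 1 < K then M i j else z i (j+1)
  have z0 : ∀ i, z' i 0 = z i 0 := fun i => rfl
  have zlt : ∀ i j, j + 1 < K → z' i (j+1) = M i j := fun i j h => if_pos h
  have zge : ∀ i j, ¬ (j + 1 < K) → z' i (j+1) = z i (j+1) := fun i j h => if_neg h
  have vb : ∀ i j, D (M i j) (M (i+1) j) ≤ (D (z i j) (z (i+1) j) + D (z i (j+2)) (z (i+1) (j+2))) / 2 :=
    fun i j => hr.bus2 G (h2' i j) (h4 i j) (h2' (i+1) j) (hM i j) (hM (i+1) j)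
  refine ⟨z', ⟨?_, ?_, ?_, ?_, ?_, ?_⟩, ?_⟩
  · intro i j
    rcases j with _ | j
    · rw [z0]
      by_cases h : 0 + 1 < K
      · rw [zlt i 0 h, (hM i 0).1]
        have := h2 i 0; linarith
      · rw [zge i 0 h]; exact g.h i 0
    · by_cases h : j + 1 + 1 < K
      · rw [zlt i (j+1) h, zlt i j (by omega)]
        have := hr.bus2 G (h2' i j) (h3 i j) (h2' i (j+1)) (hM i j) (hM i (j+1))
        have e1 := g.h i j
        have e2 := g.h i (j+2)
        refine this.trans ?_
        linarith
      · rw [zge i (j+1) h]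
        by_cases h' : j + 1 < K
        · rw [zlt i j h', D_comm, (hM i j).2]
          have := h2 i j; linarith
        · rw [zge i j h']; exact g.h i (j+1)
  · intro i j
    rcases j with _ | j
    · exact g.v i 0
    · by_cases h : j + 1 < K
      · rw [zlt i j h, zlt (i+1) j h]
        have := vb i j
        have e1 := g.v i j
        have e2 := g.v i (j+2)
        linarith
      · rw [zge i j h, zge (i+1) j h]; exact g.v i (j+1)
  · intro j
    rcases j with _ | j
    · exact g.r0 0
    · by_cases h : j + 1 < K
      · rw [zlt 0 j h]
        apply uniq
        rw [g.r0, g.r0]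
        simp [IsMid, D_self]
      · rw [zge 0 j h]; exact g.r0 _
  · intro j
    rcases j with _ | j
    · exact g.rn 0
    · by_cases h : j + 1 < K
      · rw [zlt n j h]
        apply uniq
        rw [g.rn, g.rn]
        exact hq j h
      · rw [zge n j h]; exact g.rn _
  · intro i; exact g.c0 i
  · intro i
    rcases K with _ | K
    · exact g.cK i
    · rw [zge i K (by omega)]; exact g.cK i
  · intro j h
    unfold VV
    rw [← Finset.sum_add_distrib, Finset.sum_div]
    refine Finset.sum_le_sum fun i _ => ?_
    rw [zlt i j h, zlt (i+1) j h]
    exact vb i j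

lemma Grid.flow (G : Good X) {r δ : ℝ} (hr : CN X r) (hδ : 3 * δ < r) {p : X} {q A B : ℕ → X} {n K : ℕ}
    (hK : 0 < K) (hq : ∀ j, j + 1 < K → IsMid (q j) (q (j+2)) (q (j+1)))
    {z : ℕ → ℕ → X} (g : Grid p q A B n K δ z) {ζ : ℝ}
    (hA : ∑ i ∈ Finset.range n, D (A i) (A (i+1)) ≤ ζ)
    (hB : ∑ i ∈ Finset.range n, D (B i) (B (i+1)) ≤ ζ) {ε : ℝ} (hε : 0 < ε) :
    ∃ z', Grid p q A B n K δ z' ∧ ∀ j ≤ K, VV n z' j ≤ ζ + ε := by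
  have hζ : 0 ≤ ζ := (Finset.sum_nonneg fun _ _ => D_nonneg _ _).trans hA
  have hKr : (1:ℝ) ≤ K := by exact_mod_cast hK
  have hK2 : (1:ℝ) ≤ (K:ℝ)^2 := by nlinarith
  set θ : ℝ := 1 - 1 / (2 * (K:ℝ)^2) with hθ
  have hinv : 1 / (2 * (K:ℝ)^2) ≤ 1 / 2 := by
    apply one_div_le_one_div_of_le <;> linarith
  have hinv0 : 0 < 1 / (2 * (K:ℝ)^2) := by positivity
  have hθ0 : 0 ≤ θ := by linarith
  have hθ1 : θ < 1 := by linarith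
  set C : ℝ := ∑ j ∈ Finset.range (K+1), VV n z j with hC
  have hC0 : 0 ≤ C := Finset.sum_nonneg fun _ _ => VV_nonneg _ _ _
  have hφ : ∀ j : ℕ, j ≤ K → 1 ≤ 2 * (K:ℝ)^2 - (j:ℝ)^2 := by
    intro j hj
    have : (j:ℝ) ≤ K := by exact_mod_cast hj
    have h0 : (0:ℝ) ≤ j := by positivity
    nlinarith
  have main : ∀ k : ℕ, ∃ z', Grid p q A B n K δ z' ∧
      ∀ j ≤ K, VV n z' j ≤ ζ + C * θ ^ k * (2 * (K:ℝ)^2 - (j:ℝ)^2) := by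
    intro k
    induction k with
    | zero =>
      refine ⟨z, g, fun j hj => ?_⟩
      have h1 : VV n z j ≤ C := Finset.single_le_sum (f := fun j => VV n z j) (fun _ _ => VV_nonneg _ _ _) (by simp; omega)
      have := hφ j hj
      simp only [pow_zero, mul_one]
      nlinarith
    | succ k ih =>
      obtain ⟨z1, g1, hz1⟩ := ih
      obtain ⟨z2, g2, hz2⟩ := g1.step G hr hδ hq
      refine ⟨z2, g2, fun j hj => ?_⟩
      have hCk : 0 ≤ C * θ ^ k := by positivity
      have hCk' : 0 ≤ C * θ ^ (k+1) := by positivity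
      rcases j with _ | j
      · have e : VV n z2 0 ≤ ζ := by
          unfold VV; simp only [g2.c0]; exact hA
        have := hφ 0 hj
        nlinarith
      · rcases hj.eq_or_lt with h | h
        · have e : VV n z2 K ≤ ζ := by
            unfold VV; simp only [g2.cK]; exact hB
          have := hφ K le_rfl
          rw [h]
          nlinarith
        · have e := hz2 j h
          have e1 := hz1 j (by omega)
          have e2 := hz1 (j+2) (by omega)
          have hφ1 := hφ (j+1) hj
          have key : (2 * (K:ℝ)^2 - ((j+1:ℕ):ℝ)^2) - 1 ≤ θ * (2 * (K:ℝ)^2 - ((j+1:ℕ):ℝ)^2) := by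
            have : 1 / (2 * (K:ℝ)^2) * (2 * (K:ℝ)^2 - ((j+1:ℕ):ℝ)^2) ≤ 1 := by
              rw [one_div, inv_mul_le_iff₀ (by positivity)]
              nlinarith [sq_nonneg ((j+1:ℕ):ℝ)]
            rw [hθ]; linarith
          have e3 := mul_le_mul_of_nonneg_left key hCk
          have e4 : C * θ ^ (k+1) = C * θ ^ k * θ := by ring
          rw [e4]
          push_cast at *
          nlinarith
  have ht : Filter.Tendsto (fun k : ℕ => C * θ ^ k * (2 * (K:ℝ)^2)) Filter.atTop (nhds 0) := by
    have := ((tendsto_pow_atTop_nhds_zero_of_lt_one hθ0 hθ1).const_mul C).mul_const (2 * (K:ℝ)^2)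
    simpa using this
  obtain ⟨k, hk⟩ := (ht.eventually (gt_mem_nhds hε)).exists
  obtain ⟨z', g', h'⟩ := main k
  refine ⟨z', g', fun j hj => (h' j hj).trans ?_⟩
  have : 0 ≤ C * θ ^ k := by positivity
  nlinarith [sq_nonneg (j:ℝ)]

end

section
open Set Metric
open scoped ENNReal unitInterval

section homot
variable {Y : Type*} [TopologicalSpace Y]

lemma hom_assoc {a b c d : Y} (P : Path a b) (Q : Path b c) (R : Path c d) :
    ((P.trans Q).trans R).Homotopic (P.trans (Q.trans R)) := ⟨Path.Homotopy.transAssoc P Q R⟩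
lemma hom_refl_trans {a b : Y} (P : Path a b) : ((Path.refl a).trans P).Homotopic P :=
  ⟨Path.Homotopy.reflTrans P⟩
lemma hom_trans_refl {a b : Y} (P : Path a b) : (P.trans (Path.refl b)).Homotopic P :=
  ⟨Path.Homotopy.transRefl P⟩
lemma hom_cast {a b a' b' : Y} {P Q : Path a b} (h : P.Homotopic Q) (e : a' = a) (e' : b' = b) :
    (P.cast e e').Homotopic (Q.cast e e') := by subst e; subst e'; exact h

/-- chain along a family of connecting paths -/
def kch (κ : ∀ a b : Y, Path a b) (w : ℕ → Y) (n : ℕ) : Path (w 0) (w n) :=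
  chain w (fun i => κ (w i) (w (i+1))) n

lemma kch_zero (κ : ∀ a b : Y, Path a b) (w : ℕ → Y) : kch κ w 0 = Path.refl _ := rfl
lemma kch_succ (κ : ∀ a b : Y, Path a b) (w : ℕ → Y) (n : ℕ) :
    kch κ w (n+1) = (kch κ w n).trans (κ (w n) (w (n+1))) := rfl

lemma kch_square (κ : ∀ a b : Y, Path a b) (w w' : ℕ → Y) (n : ℕ)
    (h : ∀ i < n, ((κ (w i) (w (i+1))).trans (κ (w (i+1)) (w' (i+1)))).Homotopic
      ((κ (w i) (w' i)).trans (κ (w' i) (w' (i+1))))) :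
    ((kch κ w n).trans (κ (w n) (w' n))).Homotopic ((κ (w 0) (w' 0)).trans (kch κ w' n)) := by
  induction n with
  | zero => exact (hom_refl_trans _).trans (hom_trans_refl _).symm
  | succ n ih =>
    rw [kch_succ, kch_succ]
    have ih := ih (fun i hi => h i (by omega))
    refine (hom_assoc _ _ _).trans ?_
    refine ((Path.Homotopic.refl _).hcomp (h n (by omega))).trans ?_
    refine (hom_assoc _ _ _).symm.trans ?_
    refine (ih.hcomp (Path.Homotopic.refl _)).trans ?_
    exact hom_assoc _ _ _

lemma kch_grid (κ : ∀ a b : Y, Path a b) (z : ℕ → ℕ → Y) (n m : ℕ)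
    (h : ∀ i < n, ∀ j < m, ((κ (z i j) (z (i+1) j)).trans (κ (z (i+1) j) (z (i+1) (j+1)))).Homotopic
      ((κ (z i j) (z i (j+1))).trans (κ (z i (j+1)) (z (i+1) (j+1))))) :
    ((kch κ (fun i => z i 0) n).trans (kch κ (fun j => z n j) m)).Homotopic
      ((kch κ (fun j => z 0 j) m).trans (kch κ (fun i => z i m) n)) := by
  induction m with
  | zero => exact (hom_trans_refl _).trans (hom_refl_trans _).symm
  | succ m ih =>
    rw [kch_succ, kch_succ]
    have ih := ih (fun i hi j hj => h i hi j (by omega))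
    refine (hom_assoc _ _ _).symm.trans ?_
    refine (ih.hcomp (Path.Homotopic.refl _)).trans ?_
    refine (hom_assoc _ _ _).trans ?_
    have := kch_square κ (fun i => z i m) (fun i => z i (m+1)) n (fun i hi => h i hi m (by omega))
    refine ((Path.Homotopic.refl _).hcomp this).trans ?_
    exact (hom_assoc _ _ _).symm

lemma kch_subpath' (κ : ∀ a b : Y, Path a b) {a b : Y} (τ : Path a b) (t : ℕ → I) (n : ℕ)
    (h : ∀ i < n, (κ (τ (t i)) (τ (t (i+1)))).Homotopic (τ.subpath (t i) (t (i+1)))) :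
    (kch κ (fun i => τ (t i)) n).Homotopic (τ.subpath (t 0) (t n)) := by
  induction n with
  | zero => rw [Path.subpath_self]; exact Path.Homotopic.refl _
  | succ n ih =>
    rw [kch_succ]
    have ih := ih (fun i hi => h i (by omega))
    exact (ih.hcomp (h n (by omega))).trans ⟨Path.Homotopy.subpathTransSubpath τ _ _ _⟩

lemma kch_subpath (κ : ∀ a b : Y, Path a b) {a b : Y} (τ : Path a b) (t : ℕ → I) (n : ℕ)
    (w : ℕ → Y) (hw : ∀ i, w i = τ (t i))
    (h : ∀ i < n, (κ (τ (t i)) (τ (t (i+1)))).Homotopic (τ.subpath (t i) (t (i+1)))) :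
    (kch κ w n).Homotopic ((τ.subpath (t 0) (t n)).cast (hw 0) (hw n)) := by
  obtain rfl : w = fun i => τ (t i) := funext hw
  exact kch_subpath' κ τ t n h

lemma combine {p a b : Y} {w00 wn0 w0j wnj : Y} (e1 : w00 = p) (e2 : wn0 = a) (e3: w0j = p)
    (e4 : wnj = b) (P : Path w00 wn0) (Q : Path wn0 wnj) (R : Path w00 w0j) (S : Path w0j wnj)
    (α : Path p a) (τ : Path a b) (h : (P.trans Q).Homotopic (R.trans S))
    (hP : P.Homotopic (α.cast e1 e2)) (hQ : Q.Homotopic (τ.cast e2 e4))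
    (hR : R.Homotopic ((Path.refl p).cast e1 e3)) :
    (α.trans τ).Homotopic (S.cast e3.symm e4.symm) := by
  subst e1 e2 e3 e4
  exact ((hP.hcomp hQ).symm.trans h).trans ((hR.hcomp (Path.Homotopic.refl _)).trans (hom_refl_trans _))

end homot

variable {X : Set E2}

lemma mCost_le {a b : X} {P Q : Path a b} (h : P.Homotopic Q) : mCost P ≤ cost Q :=
  iInf_le (fun s : {σ' : Path a b // P.Homotopic σ'} => cost s.1) ⟨Q, h⟩

lemma mCost_congr {a b : X} {P Q : Path a b} (h : P.Homotopic Q) : mCost P ≤ mCost Q :=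
  le_iInf fun s => mCost_le (h.trans s.2)

lemma cost_kch_le (κ : ∀ a b : X, Path a b) (w : ℕ → X) (n : ℕ) {ε : ℝ} (hε : 0 ≤ ε)
    (h : ∀ a b, cost (κ a b) ≤ ENNReal.ofReal (D a b + ε)) :
    cost (kch κ w n) ≤ ENNReal.ofReal (∑ i ∈ Finset.range n, D (w i) (w (i+1)) + n * ε) := by
  induction n with
  | zero => rw [kch_zero, cost_refl]; exact zero_le
  | succ n ih =>
    rw [kch_succ]
    refine (cost_trans_le _ _).trans ((add_le_add ih (h _ _)).trans ?_)
    have h0 : 0 ≤ ∑ i ∈ Finset.range n, D (w i) (w (i+1)) := Finset.sum_nonneg fun _ _ => D_nonneg _ _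
    have h1 := D_nonneg (w n) (w (n+1))
    rw [← ENNReal.ofReal_add (by positivity) (by positivity), Finset.sum_range_succ]
    apply ENNReal.ofReal_le_ofReal
    push_cast
    linarith

lemma Good.D_le_var (G : Good X) {a b : X} (α : Path a b) {s t : I} (h : s ≤ t) :
    ENNReal.ofReal (D (α s) (α t)) ≤ eVariationOn (fun t => (α t : E2)) (Icc s t) :=
  (G.D_le_cost _).trans (cost_subpath_le α h)

lemma Good.sum_le (G : Good X) {a b : X} (α : Path a b) (t : ℕ → I) (ht : Monotone t) (n : ℕ) {ζ : ℝ}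
    (hζ : 0 ≤ ζ) (hc : cost α ≤ ENNReal.ofReal ζ) :
    ∑ i ∈ Finset.range n, D (α (t i)) (α (t (i+1))) ≤ ζ := by
  have key : ENNReal.ofReal (∑ i ∈ Finset.range n, D (α (t i)) (α (t (i+1)))) ≤
      eVariationOn (fun t => (α t : E2)) (Icc (t 0) (t n)) := by
    induction n with
    | zero => simp
    | succ n ih =>
      rw [Finset.sum_range_succ, ENNReal.ofReal_add (Finset.sum_nonneg fun _ _ => D_nonneg _ _) (D_nonneg _ _),
        ← Icc_add (ht (Nat.zero_le n)) (ht (Nat.le_succ n))]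
      exact add_le_add ih (G.D_le_var α (ht (Nat.le_succ n)))
  have := (key.trans (eVariationOn.mono _ (subset_univ _))).trans hc
  exact (ENNReal.ofReal_le_ofReal_iff hζ).1 this

/-- paths of small cost are homotopic -/
lemma dist_lt_of_cost {a b : X} {γ : Path a b} {r : ℝ} (h : cost γ < ENNReal.ofReal r) (t : I) :
    dist a (γ t) < r := by
  have := (edist_le_cost γ 0 t).trans_lt h
  rw [Path.source, edist_dist] at this
  exact ENNReal.ofReal_lt_ofReal_iff_of_nonneg dist_nonneg |>.1 this

lemma dist_lt_of_subpath {a b : X} {γ : Path a b} {r : ℝ} {s t : I} (hst : s ≤ t)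
    (h : ∀ v ∈ Icc s t, dist (γ s) (γ v) < r) (u : I) : dist (γ s) (γ.subpath s t u) < r := by
  have := Path.range_subpath_of_le γ s t hst
  have h1 : γ.subpath s t u ∈ γ '' Icc s t := this ▸ mem_range_self u
  obtain ⟨v, hv, e⟩ := h1
  rw [← e]; exact h v hv

end

section
open Set Metric
open scoped ENNReal unitInterval

lemma dbl_cont : Continuous dbl := Continuous.subtype_mk (by fun_prop) _
lemma dbl'_cont : Continuous dbl' := Continuous.subtype_mk (by fun_prop) _

lemma H_exists {Y : Type*} [TopologicalSpace Y] {p a b : Y} (α : Path p a) (β : Path p b) (γ : Path a b)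
    (hγ : γ.Homotopic (α.symm.trans β)) :
    ∃ H : I × I → Y, Continuous H ∧ (∀ u, H (0,u) = p) ∧ (∀ u, H (1,u) = γ u) ∧
      (∀ t, H (t,0) = α (dbl t)) ∧ ∀ t, H (t,1) = β (dbl t) := by
  obtain ⟨F⟩ := hγ
  refine ⟨fun x => F (unitInterval.symm (dbl' x.1), Set.Icc.convexComb hlf x.2 (dbl x.1)), ?_, ?_, ?_, ?_, ?_⟩
  · refine F.continuous.comp (Continuous.prodMk ?_ ?_)
    · exact unitInterval.continuous_symm.comp (dbl'_cont.comp continuous_fst)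
    · exact Set.Icc.continuous_convexComb_prod.comp (continuous_const.prodMk (continuous_snd.prodMk (dbl_cont.comp continuous_fst)))
  · intro u
    have e1 : unitInterval.symm (dbl' 0) = 1 := Subtype.ext (by simp [dbl'])
    have e2 : Set.Icc.convexComb hlf u (dbl 0) = hlf := Subtype.ext (by
      show (1 - (dbl 0).1) * hlf.1 + (dbl 0).1 * u.1 = hlf.1
      simp [dbl])
    have e3 : dbl hlf = 1 := Subtype.ext (by norm_num [dbl, hlf])
    simp only [e1, e2]
    rw [F.apply_one]
    show (α.symm.trans β) hlf = p
    rw [trans_left _ _ le_rfl, e3, Path.target]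
  · intro u
    have e1 : unitInterval.symm (dbl' 1) = 0 := Subtype.ext (by norm_num [dbl'])
    have e2 : Set.Icc.convexComb hlf u (dbl 1) = u := Subtype.ext (by
      show (1 - (dbl 1).1) * hlf.1 + (dbl 1).1 * u.1 = u.1
      norm_num [dbl])
    simp only [e1, e2]
    rw [F.apply_zero]; rfl
  · intro t
    rcases le_total t hlf with h | h
    · have h' : t.1 ≤ 1/2 := h
      have e1 : unitInterval.symm (dbl' t) = 1 := Subtype.ext (by
        show 1 - max 0 (2 * t.1 - 1) = 1
        rw [max_eq_left (by linarith)]; simp)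
      have e0 : (dbl t).1 = 2 * t.1 := min_eq_right (by linarith)
      have e2 : (Set.Icc.convexComb hlf 0 (dbl t)).1 = 1/2 - t.1 := by
        show (1 - (dbl t).1) * hlf.1 + (dbl t).1 * 0 = _
        rw [e0]; simp only [hlf]; ring
      have h0 : (0:ℝ) ≤ t.1 := t.2.1
      simp only [e1]
      rw [F.apply_one]
      show (α.symm.trans β) _ = _
      rw [trans_left _ _ (show (Set.Icc.convexComb hlf 0 (dbl t)).1 ≤ 1/2 by rw [e2]; linarith), Path.symm_apply]
      refine congrArg α ?_
      apply Subtype.ext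
      show 1 - min 1 (2 * (Set.Icc.convexComb hlf 0 (dbl t)).1) = _
      rw [e2, e0, min_eq_right (by linarith)]; ring
    · have h' : 1/2 ≤ t.1 := h
      have e0 : dbl t = 1 := Subtype.ext (min_eq_left (by linarith))
      simp only [e0, Path.target]
      have e2 : Set.Icc.convexComb hlf 0 (1:I) = 0 := by simp
      rw [e2, F.source]
  · intro t
    rcases le_total t hlf with h | h
    · have h' : t.1 ≤ 1/2 := h
      have e1 : unitInterval.symm (dbl' t) = 1 := Subtype.ext (by
        show 1 - max 0 (2 * t.1 - 1) = 1
        rw [max_eq_left (by linarith)]; simp)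
      have e0 : (dbl t).1 = 2 * t.1 := min_eq_right (by linarith)
      have e2 : (Set.Icc.convexComb hlf 1 (dbl t)).1 = 1/2 + t.1 := by
        show (1 - (dbl t).1) * hlf.1 + (dbl t).1 * 1 = _
        rw [e0]; simp only [hlf]; ring
      have h0 : (0:ℝ) ≤ t.1 := t.2.1
      simp only [e1]
      rw [F.apply_one]
      show (α.symm.trans β) _ = _
      rw [trans_right _ _ (show 1/2 ≤ (Set.Icc.convexComb hlf 1 (dbl t)).1 by rw [e2]; linarith)]
      congr 1
      apply Subtype.ext
      show max 0 (2 * (Set.Icc.convexComb hlf 1 (dbl t)).1 - 1) = _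
      rw [e2, e0, max_eq_right (by linarith)]; ring
    · have h' : 1/2 ≤ t.1 := h
      have e0 : dbl t = 1 := Subtype.ext (min_eq_left (by linarith))
      simp only [e0, Path.target]
      have e2 : Set.Icc.convexComb hlf 1 (1:I) = 1 := by simp
      rw [e2, F.target]

/-- uniform subdivision -/
def tau (N i : ℕ) : I := ⟨min 1 ((i:ℝ) / N), le_min zero_le_one (by positivity), min_le_left _ _⟩

lemma tau_mono (N : ℕ) : Monotone (tau N) := fun i j h => Subtype.mk_le_mk.2
  (min_le_min le_rfl (by gcongr))
lemma tau_zero (N : ℕ) : tau N 0 = 0 := Subtype.ext (by simp [tau])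
lemma tau_val {N i : ℕ} (hN : 0 < N) (h : i ≤ N) : (tau N i).1 = (i:ℝ) / N :=
  min_eq_right ((div_le_one (by positivity)).2 (by exact_mod_cast h))
lemma tau_self {N : ℕ} (hN : 0 < N) : tau N N = 1 := Subtype.ext (by
  rw [tau_val hN le_rfl, div_self (by positivity)]; rfl)
lemma tau_step (N i : ℕ) : (tau N (i+1)).1 ≤ (tau N i).1 + 1 / N := by
  show min 1 (((i+1:ℕ):ℝ) / N) ≤ min 1 ((i:ℝ) / N) + 1 / N
  have : ((i+1:ℕ):ℝ) / N = (i:ℝ)/N + 1/N := by push_cast; ring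
  rw [this]
  have h0 : (0:ℝ) ≤ 1 / N := by positivity
  rcases le_total 1 ((i:ℝ)/N) with h | h
  · rw [min_eq_left h]; exact (min_le_left _ _).trans (by linarith)
  · rw [min_eq_right h]; exact min_le_right _ _
lemma dbl_step {s t : I} {x : ℝ} (hx : 0 ≤ x) (h : t.1 ≤ s.1 + x) : (dbl t).1 ≤ (dbl s).1 + 2 * x := by
  show min 1 (2 * t.1) ≤ min 1 (2 * s.1) + 2 * x
  rcases le_total 1 (2 * s.1) with h' | h'
  · rw [min_eq_left h']; exact (min_le_left _ _).trans (by linarith)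
  · rw [min_eq_right h']; exact (min_le_right _ _).trans (by linarith)

lemma sub0_split {Y : Type*} [TopologicalSpace Y] {a b : Y} (γ : Path a b) (s t : I) :
    (((γ.subpath 0 s).cast γ.source.symm rfl).trans (γ.subpath s t)).Homotopic
      ((γ.subpath 0 t).cast γ.source.symm rfl) := by
  have := hom_cast (⟨Path.Homotopy.subpathTransSubpath γ 0 s t⟩ : ((γ.subpath 0 s).trans (γ.subpath s t)).Homotopic _)
    γ.source.symm rfl
  exact this

lemma dist_lt_I {s t : I} {x : ℝ} (h : s ≤ t) (h' : t.1 < s.1 + x) : dist s t < x := by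
  have : s.1 ≤ t.1 := h
  rw [Subtype.dist_eq, dist_comm, Real.dist_eq, abs_of_nonneg (by linarith)]
  linarith

variable {X : Set E2}

lemma core_const (G : Good X) {p a b : X} (α : Path p a) (β : Path p b) (γ : Path a b)
    (hγ : γ.Homotopic (α.symm.trans β)) {ζ : ℝ} (hζ : 0 ≤ ζ)
    (hα : cost α ≤ ENNReal.ofReal ζ) (hβ : cost β ≤ ENNReal.ofReal ζ)
    {L r₃ : ℝ} (hL : 0 ≤ L) (hr₃ : 0 < r₃)
    (hD : ∀ u u' : I, u ≤ u' → L * (u'.1 - u.1) < r₃ → D (γ u) (γ u') = L * (u'.1 - u.1)) (t : I) :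
    mCost (α.trans ((γ.subpath 0 t).cast γ.source.symm rfl)) ≤ ENNReal.ofReal ζ := by
  obtain ⟨H, Hc, H0, H1, Hα, Hβ⟩ := H_exists α β γ hγ
  obtain ⟨r, hr, hcn⟩ := G.exists_cn
  obtain ⟨r₂, hr₂, hhom⟩ := G.homot
  suffices hh : ∀ ε : ℝ, 0 < ε → mCost (α.trans ((γ.subpath 0 t).cast γ.source.symm rfl)) ≤ ENNReal.ofReal (ζ + ε) by
    apply ENNReal.le_of_forall_pos_le_add
    intro ε hε _
    refine (hh ε (by exact_mod_cast hε)).trans ?_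
    rw [ENNReal.ofReal_add hζ (by positivity)]
    simp
  intro ε hε
  obtain ⟨δ, hδ0, hδr, hδr₂⟩ : ∃ δ > 0, 3 * δ < r ∧ 4 * δ < r₂ :=
    ⟨min (r/4) (r₂/5), lt_min (by linarith) (by linarith),
      by have := min_le_left (r/4) (r₂/5); linarith, by have := min_le_right (r/4) (r₂/5); linarith⟩
  obtain ⟨η₀, hη₀, hDu⟩ := G.unif hδ0
  obtain ⟨η, hη, hHu⟩ := Metric.uniformContinuous_iff.1 (CompactSpace.uniformContinuous_of_continuous Hc) η₀ hη₀
  obtain ⟨ηα, hηα, hαu⟩ := Metric.uniformContinuous_iff.1 (CompactSpace.uniformContinuous_of_continuous α.continuous) r₂ hr₂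
  obtain ⟨ηγ, hηγ, hγu⟩ := Metric.uniformContinuous_iff.1 (CompactSpace.uniformContinuous_of_continuous γ.continuous) r₂ hr₂
  -- choose N
  have ht1 : Filter.Tendsto (fun N : ℕ => 1 / (N:ℝ)) Filter.atTop (nhds 0) := tendsto_one_div_atTop_nhds_zero_nat
  have ht2 : Filter.Tendsto (fun N : ℕ => L * (1 / (N:ℝ))) Filter.atTop (nhds 0) := by
    simpa using ht1.const_mul L
  obtain ⟨N, hN0, hN1, hN2, hN3, hN4, hN5⟩ : ∃ N : ℕ, 0 < N ∧ 1 / (N:ℝ) < η ∧ 1 / (N:ℝ) < ηα / 2 ∧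
      1 / (N:ℝ) < ηγ ∧ L * (1 / (N:ℝ)) < r₃ / 2 ∧ L * (1 / (N:ℝ)) < min (ε / 4) δ :=
    ((Filter.eventually_gt_atTop 0).and ((ht1.eventually (gt_mem_nhds hη)).and
      ((ht1.eventually (gt_mem_nhds (half_pos hηα))).and ((ht1.eventually (gt_mem_nhds hηγ)).and
      ((ht2.eventually (gt_mem_nhds (half_pos hr₃))).and
        (ht2.eventually (gt_mem_nhds (lt_min (by positivity : 0 < ε/4) hδ0)))))))).exists
  have hNr : (0:ℝ) < N := by exact_mod_cast hN0
  have h1N : (0:ℝ) ≤ 1 / N := by positivity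
  obtain ⟨ε', hε'0, hε'1, hε'2⟩ : ∃ ε' > 0, ε' ≤ δ ∧ (N + 1) * ε' ≤ ε / 4 := by
    refine ⟨min δ (ε / 4 / (N+1)), lt_min hδ0 (by positivity), min_le_left _ _, ?_⟩
    have : min δ (ε / 4 / (N+1)) ≤ ε / 4 / (N+1) := min_le_right _ _
    calc (N + 1) * min δ (ε / 4 / (N+1)) ≤ (N+1) * (ε / 4 / (N+1)) := by gcongr
      _ = ε / 4 := by field_simp
  choose κ hκ using fun a b : X => G.exists_path a b hε'0
  -- grid
  have step_lt : ∀ i, dist (tau N i) (tau N (i+1)) ≤ 1 / N := fun i => by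
    have h1 : (tau N i).1 ≤ (tau N (i+1)).1 := tau_mono N (Nat.le_succ i)
    have h2 := tau_step N i
    rw [Subtype.dist_eq, dist_comm, Real.dist_eq, abs_of_nonneg (by linarith)]
    linarith
  have g : Grid p (fun j => γ (tau N j)) (fun i => α (dbl (tau N i))) (fun i => β (dbl (tau N i))) N N δ
      (fun i j => H (tau N i, tau N j)) := by
    refine ⟨?_, ?_, ?_, ?_, ?_, ?_⟩
    · intro i j
      refine (hDu _ _ (hHu ?_)).le
      rw [Prod.dist_eq]
      simp only [dist_self]
      exact max_lt hη ((step_lt j).trans_lt hN1)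
    · intro i j
      refine (hDu _ _ (hHu ?_)).le
      rw [Prod.dist_eq]
      simp only [dist_self]
      exact max_lt ((step_lt i).trans_lt hN1) hη
    · intro j; simp only [tau_zero]; exact H0 _
    · intro j; simp only [tau_self hN0]; exact H1 _
    · intro i; simp only [tau_zero]; exact Hα _
    · intro i; simp only [tau_self hN0]; exact Hβ _
  have hq : ∀ j, j + 1 < N → IsMid (γ (tau N j)) (γ (tau N (j+2))) (γ (tau N (j+1))) := by
    intro j hj
    have e0 := tau_val hN0 (show j ≤ N by omega)
    have e1 := tau_val hN0 (show j + 1 ≤ N by omega)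
    have e2 := tau_val hN0 (show j + 2 ≤ N by omega)
    have d01 : (tau N (j+1)).1 - (tau N j).1 = 1 / N := by rw [e0, e1]; push_cast; ring
    have d12 : (tau N (j+2)).1 - (tau N (j+1)).1 = 1 / N := by rw [e1, e2]; push_cast; ring
    have d02 : (tau N (j+2)).1 - (tau N j).1 = 2 * (1 / N) := by linarith
    have D01 := hD _ _ (tau_mono N (show j ≤ j + 1 by omega)) (by rw [d01]; linarith)
    have D12 := hD _ _ (tau_mono N (show j + 1 ≤ j + 2 by omega)) (by rw [d12]; linarith)
    have D02 := hD _ _ (tau_mono N (show j ≤ j + 2 by omega)) (by rw [d02]; linarith)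
    rw [d01] at D01
    rw [d12] at D12
    rw [d02] at D02
    refine ⟨?_, ?_⟩
    · rw [D01, D02]; ring
    · rw [D_comm, D12, D02]; ring
  obtain ⟨z, gz, hV⟩ := g.flow G hcn hδr hN0 hq
    (G.sum_le α (fun i => dbl (tau N i)) (dbl_mono.comp (tau_mono N)) N hζ hα)
    (G.sum_le β (fun i => dbl (tau N i)) (dbl_mono.comp (tau_mono N)) N hζ hβ) (show 0 < ε / 4 by positivity)
  -- small paths
  have hκs : ∀ a b : X, D a b ≤ δ → cost (κ a b) ≤ ENNReal.ofReal (2 * δ) := fun a b hab =>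
    (hκ a b).trans (ENNReal.ofReal_le_ofReal (by linarith))
  have hκκ : ∀ a b c : X, D a b ≤ δ → D b c ≤ δ → ∀ u, dist a ((κ a b).trans (κ b c) u) < r₂ := by
    intro a b c h1 h2
    apply dist_lt_of_cost
    refine ((cost_trans_le _ _).trans (add_le_add (hκs _ _ h1) (hκs _ _ h2))).trans_lt ?_
    rw [← ENNReal.ofReal_add (by positivity) (by positivity)]
    exact (ENNReal.ofReal_lt_ofReal_iff hr₂).2 (by linarith)
  have hκ1 : ∀ a b : X, D a b ≤ δ → ∀ u, dist a (κ a b u) < r₂ := by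
    intro a b h1
    apply dist_lt_of_cost
    exact (hκs _ _ h1).trans_lt ((ENNReal.ofReal_lt_ofReal_iff hr₂).2 (by linarith))
  -- the position of t
  set j := ⌊t.1 * N⌋₊ with hj
  have ht0 : 0 ≤ t.1 := t.2.1
  have ht1' : t.1 ≤ 1 := t.2.2
  have hjN : j ≤ N := by
    have : (j:ℝ) ≤ t.1 * N := Nat.floor_le (by positivity)
    have h2 : (j:ℝ) ≤ N := this.trans (by nlinarith)
    exact_mod_cast h2
  have hs : (tau N j).1 = j / N := tau_val hN0 hjN
  have hst : tau N j ≤ t := by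
    show (tau N j).1 ≤ t.1
    rw [hs, div_le_iff₀ hNr]
    exact Nat.floor_le (by positivity)
  have hst' : t.1 < (tau N j).1 + 1 / N := by
    have := Nat.lt_floor_add_one (t.1 * N)
    rw [hs, ← add_div, lt_div_iff₀ hNr]
    exact this
  have hstD : D (γ (tau N j)) (γ t) ≤ L * (1 / N) := by
    have : L * (t.1 - (tau N j).1) ≤ L * (1 / N) := mul_le_mul_of_nonneg_left (by linarith) hL
    rw [hD _ _ hst (by linarith)]
    exact this
  have hm1 := min_le_left (ε / 4) δ
  have hm2 := min_le_right (ε / 4) δ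
  -- grid homotopy
  have hgrid := kch_grid κ z N j (fun i _ k _ => hhom _ _ _ _ (hκκ _ _ _ (gz.v _ _) (gz.h _ _))
    (hκκ _ _ _ (gz.h _ _) (gz.v _ _)))
  have hP := kch_subpath κ α (fun i => dbl (tau N i)) N (fun i => z i 0) gz.c0 (by
    intro i _
    refine hhom _ _ _ _ (hκ1 _ _ ?_) (dist_lt_of_subpath (dbl_mono (tau_mono N (Nat.le_succ i))) ?_)
    · have := gz.v i 0
      rw [gz.c0, gz.c0] at this
      exact this
    · intro v hv
      apply hαu
      have h1 : v.1 ≤ (dbl (tau N (i+1))).1 := hv.2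
      have h2 := dbl_step h1N (tau_step N i)
      exact dist_lt_I hv.1 (by linarith))
  have hγκ : ∀ k, (κ (γ (tau N k)) (γ (tau N (k+1)))).Homotopic (γ.subpath (tau N k) (tau N (k+1))) := by
    intro k
    refine hhom _ _ _ _ (hκ1 _ _ ?_) (dist_lt_of_subpath (tau_mono N (Nat.le_succ k)) ?_)
    · have := gz.h N k
      rw [gz.rn, gz.rn] at this
      exact this
    · intro v hv
      apply hγu
      have h1 : v.1 ≤ (tau N (k+1)).1 := hv.2
      have h2 := tau_step N k
      exact dist_lt_I hv.1 (by linarith)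
  have hQ := kch_subpath κ γ (tau N) j (fun k => z N k) gz.rn (fun k _ => hγκ k)
  have hR := kch_subpath κ (Path.refl p) (fun _ => 0) j (fun k => z 0 k) gz.r0 (by
    intro k _
    exact hhom _ _ _ _ (hκ1 _ _ (by simpa [D_self] using hδ0.le)) (fun u => by
      simpa [Path.subpath_self] using hr₂))
  have e1 : z 0 0 = p := gz.r0 0
  have e2 : z N 0 = a := by rw [gz.rn, tau_zero, Path.source]
  have e3 : z 0 j = p := gz.r0 j
  have e4 : z N j = γ (tau N j) := gz.rn j
  have hfin := combine e1 e2 e3 e4 _ _ _ _ α ((γ.subpath 0 (tau N j)).cast γ.source.symm rfl) hgrid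
    (hP.trans (by
      have : (α.subpath (dbl (tau N 0)) (dbl (tau N N))).cast (gz.c0 0) (gz.c0 N) = α.cast e1 e2 := by
        have d0 : dbl 0 = 0 := Subtype.ext (by simp [dbl])
        have d1 : dbl 1 = 1 := Subtype.ext (by simp [dbl])
        ext u
        simp [Path.subpath, tau_zero, tau_self hN0, d0, d1]
      rw [this]))
    (hQ.trans (by
      have : (γ.subpath (tau N 0) (tau N j)).cast (gz.rn 0) (gz.rn j) =
          (((γ.subpath 0 (tau N j)).cast γ.source.symm rfl).cast e2 e4) := by
        ext u
        simp [Path.subpath, tau_zero]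
      rw [this]))
    (hR.trans (by
      have : ((Path.refl p).subpath 0 0).cast (gz.r0 0) (gz.r0 j) = (Path.refl p).cast e1 e3 := by
        rfl
      rw [this]))
  have hlast : (γ.subpath (tau N j) t).Homotopic (κ (γ (tau N j)) (γ t)) := by
    refine hhom _ _ _ _ (dist_lt_of_subpath hst ?_) (hκ1 _ _ (by linarith))
    intro v hv
    apply hγu
    have h1 : v.1 ≤ t.1 := hv.2
    exact dist_lt_I hv.1 (by linarith)
  have total := ((Path.Homotopic.refl α).hcomp (sub0_split γ (tau N j) t)).symm.trans
    ((hom_assoc _ _ _).symm.trans (hfin.hcomp hlast))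
  refine (mCost_le total).trans ((cost_trans_le _ _).trans ?_)
  rw [cost_cast]
  refine (add_le_add (cost_kch_le κ _ N hε'0.le hκ) (hκ _ _)).trans ?_
  have hVj := hV j hjN
  have hV0 := VV_nonneg N z j
  have := D_nonneg (γ (tau N j)) (γ t)
  unfold VV at hVj hV0
  rw [← ENNReal.ofReal_add (by positivity) (by positivity)]
  apply ENNReal.ofReal_le_ofReal
  linarith

end

section
open Set Metric
open scoped ENNReal unitInterval

lemma hom_of_factor {Y : Type*} [TopologicalSpace Y] {a b : Y} (τ : Path a b) {x y : Y} (P Q : Path x y)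
    (f g : I → I) (hf : Continuous f) (hg : Continuous g) (h0 : f 0 = g 0) (h1 : f 1 = g 1)
    (hP : ∀ s, P s = τ (f s)) (hQ : ∀ s, Q s = τ (g s)) : P.Homotopic Q := by
  have : ContractibleSpace (I : Set ℝ) := (convex_Icc (0:ℝ) 1).contractibleSpace ⟨0, by simp⟩
  let P' : Path (f 0) (f 1) := ⟨⟨f, hf⟩, rfl, rfl⟩
  let Q' : Path (f 0) (f 1) := ⟨⟨g, hg⟩, h0.symm, h1.symm⟩
  have h := (SimplyConnectedSpace.paths_homotopic P' Q').map ⟨τ, τ.continuous⟩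
  have ex : x = τ (f 0) := by rw [← hP, P.source]
  have ey : y = τ (f 1) := by rw [← hP, P.target]
  have h2 := hom_cast h ex ey
  have eP : P = (P'.map τ.continuous).cast ex ey := by ext s; exact hP s
  have eQ : Q = (Q'.map τ.continuous).cast ex ey := by ext s; exact hQ s
  rw [eP, eQ]
  exact h2

variable {X : Set E2}

lemma mCost_trans_cast {p a c c' : X} (α : Path p a) (P : Path a c) (e : c' = c) :
    mCost (α.trans (P.cast rfl e)) = mCost (α.trans P) := by subst e; rfl

lemma loc_min (G : Good X) {a b : X} (γ : Path a b) (hopt : IsOptimal γ) (hfin : cost γ ≠ ⊤) :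
    ∃ r > 0, ∀ s s' : I, s ≤ s' → (∀ v ∈ Icc s s', dist (γ s) (γ v) < r) →
      eVariationOn (fun t => (γ t : E2)) (Icc s s') = ENNReal.ofReal (D (γ s) (γ s')) := by
  obtain ⟨r₂, hr₂, hhom⟩ := G.homot
  obtain ⟨η, hη, hu⟩ := G.unif (half_pos hr₂)
  refine ⟨min η r₂, lt_min hη hr₂, fun s s' hss h => le_antisymm ?_ (G.D_le_var γ hss)⟩
  set f := (fun t => (γ t : E2)) with hf
  apply ENNReal.le_of_forall_pos_le_add
  intro ε hε _
  obtain ⟨ε', h0, h1, h2⟩ : ∃ ε' > 0, ε' ≤ (ε:ℝ) ∧ ε' < r₂ / 2 :=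
    ⟨min ε (r₂/4), lt_min (by exact_mod_cast hε) (by linarith), min_le_left _ _,
      (min_le_right _ _).trans_lt (by linarith)⟩
  obtain ⟨κ, hκ⟩ := G.exists_path (γ s) (γ s') h0
  have hDs : D (γ s) (γ s') < r₂ / 2 := hu _ _ ((h s' ⟨hss, le_rfl⟩).trans_le (min_le_left _ _))
  have hκh : (γ.subpath s s').Homotopic κ := by
    refine hhom _ _ _ _ (dist_lt_of_subpath hss fun v hv => (h v hv).trans_le (min_le_right _ _)) ?_
    exact dist_lt_of_cost (hκ.trans_lt ((ENNReal.ofReal_lt_ofReal_iff hr₂).2 (by linarith)))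
  have hom1 : ((γ.subpath 0 s).trans ((γ.subpath s s').trans (γ.subpath s' 1))).Homotopic (γ.subpath 0 1) :=
    ((Path.Homotopic.refl _).hcomp ⟨Path.Homotopy.subpathTransSubpath γ s s' 1⟩).trans
      ⟨Path.Homotopy.subpathTransSubpath γ 0 s 1⟩
  have hom2 := ((Path.Homotopic.refl (γ.subpath 0 s)).hcomp (hκh.hcomp (Path.Homotopic.refl (γ.subpath s' 1)))).symm.trans hom1
  rw [Path.subpath_zero_one] at hom2
  have hom3 := hom_cast hom2.symm γ.source.symm γ.target.symm
  have hc := hopt _ hom3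
  rw [cost_cast] at hc
  have hc2 := hc.trans ((cost_trans_le _ _).trans (add_le_add (cost_subpath_le γ unitInterval.nonneg')
    ((cost_trans_le _ _).trans (add_le_add hκ (cost_subpath_le γ unitInterval.le_one')))))
  have hsplit : cost γ = eVariationOn f (Icc 0 s) + (eVariationOn f (Icc s s') + eVariationOn f (Icc s' 1)) := by
    rw [Icc_add hss unitInterval.le_one']; exact cost_split γ s
  have ht1 : eVariationOn f (Icc 0 s) ≠ ⊤ := ne_top_of_le_ne_top hfin (eVariationOn.mono _ (subset_univ _))
  have ht2 : eVariationOn f (Icc s' 1) ≠ ⊤ := ne_top_of_le_ne_top hfin (eVariationOn.mono _ (subset_univ _))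
  rw [hsplit] at hc2
  have hc3 := (ENNReal.add_le_add_iff_left ht1).1 hc2
  have hc4 := (ENNReal.add_le_add_iff_right ht2).1 hc3
  refine hc4.trans ?_
  rw [ENNReal.ofReal_add (D_nonneg _ _) h0.le]
  gcongr
  rw [← ENNReal.ofReal_coe_nnreal]
  exact ENNReal.ofReal_le_ofReal h1

lemma core (G : Good X) {p a b : X} (α : Path p a) (β : Path p b) (γ : Path a b)
    (hγ : γ.Homotopic (α.symm.trans β)) (hopt : IsOptimal γ) {ζ : ℝ} (hζ : 0 ≤ ζ)
    (hα : cost α ≤ ENNReal.ofReal ζ) (hβ : cost β ≤ ENNReal.ofReal ζ) (t : I) :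
    mCost (α.trans ((γ.subpath 0 t).cast γ.source.symm rfl)) ≤ ENNReal.ofReal ζ := by
  have hfin : cost γ ≠ ⊤ := by
    have := (hopt _ hγ).trans ((cost_trans_le _ _).trans (add_le_add ((cost_symm_le α).trans hα) hβ))
    exact ne_top_of_le_ne_top (ENNReal.add_ne_top.2 ⟨ENNReal.ofReal_ne_top, ENNReal.ofReal_ne_top⟩) this
  set f := (fun t => (γ t : E2)) with hf
  set L := (cost γ).toReal with hL
  have hfinI : ∀ s s', eVariationOn f (Icc s s') ≠ ⊤ := fun s s' =>
    ne_top_of_le_ne_top hfin (eVariationOn.mono _ (subset_univ _))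
  by_cases hL0 : L = 0
  · have hc : cost γ = 0 := by
      rcases (ENNReal.toReal_eq_zero_iff _).1 hL0 with h | h
      · exact h
      · exact absurd h hfin
    refine (mCost_le (Path.Homotopic.refl _)).trans ((cost_trans_le _ _).trans ?_)
    rw [cost_cast]
    have h1 := (cost_subpath_le γ (unitInterval.nonneg' (t := t))).trans (eVariationOn.mono f (subset_univ _))
    have h2 : cost (γ.subpath 0 t) ≤ 0 := h1.trans hc.le
    calc _ ≤ ENNReal.ofReal ζ + 0 := add_le_add hα h2
      _ = _ := add_zero _
  have hLpos : 0 < L := lt_of_le_of_ne ENNReal.toReal_nonneg (Ne.symm hL0)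
  set ℓ : I → ℝ := fun s => (eVariationOn f (Icc 0 s)).toReal with hℓ
  have hdiff : ∀ s s', s ≤ s' → ENNReal.ofReal (ℓ s' - ℓ s) = eVariationOn f (Icc s s') := by
    intro s s' h
    have : ℓ s' - ℓ s = (eVariationOn f (Icc s s')).toReal := by
      simp only [hℓ]
      rw [← Icc_add (unitInterval.nonneg' (t := s)) h, ENNReal.toReal_add (hfinI _ _) (hfinI _ _)]
      ring
    rw [this, ENNReal.ofReal_toReal (hfinI _ _)]
  have hmono : Monotone ℓ := fun s s' h => ENNReal.toReal_mono (hfinI _ _)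
    (eVariationOn.mono _ (Icc_subset_Icc_right h))
  have hℓ0 : ℓ 0 = 0 := by simp [hℓ]
  have hℓ1 : ℓ 1 = L := by simp only [hℓ, hL, cost, univ_eq_Icc]; rfl
  have hDle : ∀ s s', s ≤ s' → D (γ s) (γ s') ≤ ℓ s' - ℓ s := by
    intro s s' h
    have := G.D_le_var γ h
    rw [← hf, ← hdiff s s' h] at this
    exact (ENNReal.ofReal_le_ofReal_iff (sub_nonneg.2 (hmono h))).1 this
  obtain ⟨r, hr, hloc⟩ := loc_min G γ hopt hfin
  have hloc' : ∀ s s', s ≤ s' → (∀ v ∈ Icc s s', dist (γ s) (γ v) < r) → ℓ s' - ℓ s = D (γ s) (γ s') := by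
    intro s s' h hv
    have := hloc s s' h hv
    rw [← hf, ← hdiff s s' h] at this
    exact (ENNReal.ofReal_eq_ofReal_iff (sub_nonneg.2 (hmono h)) (D_nonneg _ _)).1 this
  -- continuity of ℓ
  have hℓc : Continuous ℓ := by
    apply UniformContinuous.continuous
    rw [Metric.uniformContinuous_iff]
    intro ε hε
    obtain ⟨η₀, hη₀, hDu⟩ := G.unif hε
    obtain ⟨η, hη, hγu⟩ := Metric.uniformContinuous_iff.1
      (CompactSpace.uniformContinuous_of_continuous γ.continuous) (min η₀ r) (lt_min hη₀ hr)
    refine ⟨η, hη, ?_⟩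
    have key : ∀ s s' : I, s ≤ s' → dist s s' < η → dist (ℓ s) (ℓ s') < ε := by
      intro s s' h hd
      have hd' : s'.1 - s.1 < η := by
        rw [Subtype.dist_eq, dist_comm, Real.dist_eq] at hd
        exact (le_abs_self _).trans_lt hd
      have := hloc' s s' h (fun v hv => (hγu (dist_lt_I hv.1 (by
        have : v.1 ≤ s'.1 := hv.2
        linarith))).trans_le (min_le_right _ _))
      rw [dist_comm, Real.dist_eq, abs_of_nonneg (sub_nonneg.2 (hmono h)), this]
      exact hDu _ _ ((hγu hd).trans_le (min_le_left _ _))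
    intro s s' hd
    rcases le_total s s' with h | h
    · exact key s s' h hd
    · rw [dist_comm]; exact key s' s h (by rwa [dist_comm])
  have hsurj : ∀ u : I, ∃ s, ℓ s = L * u.1 := by
    intro u
    have hu0 : 0 ≤ u.1 := u.2.1
    have hu1 : u.1 ≤ 1 := u.2.2
    apply mem_range_of_exists_le_of_exists_ge hℓc
    · exact ⟨0, by rw [hℓ0]; positivity⟩
    · exact ⟨1, by rw [hℓ1]; nlinarith⟩
  choose g hg using hsurj
  have hdist : ∀ s s', dist (γ s) (γ s') ≤ |ℓ s - ℓ s'| := by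
    have key : ∀ s s', s ≤ s' → dist (γ s) (γ s') ≤ |ℓ s - ℓ s'| := fun s s' h => by
      rw [abs_sub_comm]
      exact ((G.dist_le _ _).trans (hDle s s' h)).trans (le_abs_self _)
    intro s s'
    rcases le_total s s' with h | h
    · exact key s s' h
    · rw [dist_comm, abs_sub_comm]; exact key s' s h
  let φ : I → I := fun s => ⟨ℓ s / L, div_nonneg ENNReal.toReal_nonneg hLpos.le, by
    rw [div_le_one hLpos, ← hℓ1]; exact hmono unitInterval.le_one'⟩
  have hφ : ∀ s, L * (φ s).1 = ℓ s := fun s => mul_div_cancel₀ _ hL0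
  have hφc : Continuous φ := Continuous.subtype_mk (hℓc.div_const _) _
  have hφ0 : φ 0 = 0 := Subtype.ext (by show ℓ 0 / L = 0; rw [hℓ0, zero_div])
  have hφ1 : φ 1 = 1 := Subtype.ext (by show ℓ 1 / L = 1; rw [hℓ1, div_self hL0])
  have hgφ : ∀ s, γ (g (φ s)) = γ s := by
    intro s
    apply dist_le_zero.1
    refine (hdist _ _).trans ?_
    rw [hg, hφ]; simp
  let γ' : Path a b :=
    { toFun := fun u => γ (g u)
      continuous_toFun := by
        apply UniformContinuous.continuous
        rw [Metric.uniformContinuous_iff]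
        intro ε hε
        refine ⟨ε / L, by positivity, fun {u v} huv => (hdist _ _).trans_lt ?_⟩
        rw [hg, hg, ← mul_sub, abs_mul, abs_of_pos hLpos]
        rw [lt_div_iff₀ hLpos] at huv
        rw [mul_comm]; exact huv
      source' := by
        have := hgφ 0
        rw [hφ0] at this; rw [this, γ.source]
      target' := by
        have := hgφ 1
        rw [hφ1] at this; rw [this, γ.target] }
  have hγ' : ∀ s, γ s = γ' (φ s) := fun s => (hgφ s).symm
  have hhom : γ'.Homotopic γ := hom_of_factor γ' γ' γ id φ continuous_id hφc (by simp [hφ0]) (by simp [hφ1])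
    (fun _ => rfl) hγ'
  have hgm : ∀ u u' : I, u ≤ u' → u = u' ∨ g u ≤ g u' := by
    intro u u' h
    by_contra hh
    push Not at hh
    have h1 := hmono hh.2.le
    rw [hg, hg] at h1
    have h2 : u'.1 ≤ u.1 := le_of_mul_le_mul_left h1 hLpos
    exact hh.1 (le_antisymm h h2)
  have hDγ' : ∀ u u' : I, u ≤ u' → L * (u'.1 - u.1) < r → D (γ' u) (γ' u') = L * (u'.1 - u.1) := by
    intro u u' h hlt
    rcases hgm u u' h with e | e
    · subst e; simp [D_self]
    · show D (γ (g u)) (γ (g u')) = _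
      rw [← hloc' (g u) (g u') e, hg, hg]
      · ring
      · intro v hv
        refine (hdist _ _).trans_lt ?_
        have h1 := hmono hv.1
        have h2 := hmono hv.2
        rw [abs_sub_comm, abs_of_nonneg (by linarith)]
        rw [hg] at h2 ⊢
        linarith
  have hmain := core_const G α β γ' (hhom.trans hγ) hζ hα hβ hLpos.le hr hDγ' (φ t)
  rw [← mCost_trans_cast α _ (hγ' t)] at hmain
  refine (mCost_congr ((Path.Homotopic.refl α).hcomp ?_)).trans hmain
  refine hom_of_factor γ' _ _ (fun s => φ (Set.Icc.convexComb 0 t s)) (fun s => Set.Icc.convexComb 0 (φ t) s)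
    ?_ ?_ ?_ ?_ ?_ ?_
  · exact hφc.comp (Set.Icc.continuous_convexComb_prod.comp (continuous_const.prodMk (continuous_const.prodMk continuous_id)))
  · exact Set.Icc.continuous_convexComb_prod.comp (continuous_const.prodMk (continuous_const.prodMk continuous_id))
  · simp [hφ0]
  · simp
  · intro s; exact hγ' _
  · intro s; rfl

end

section
open Set Metric
open scoped ENNReal unitInterval

lemma cont_comb (a b : I) : Continuous fun s : I => Set.Icc.convexComb a b s :=
  Set.Icc.continuous_convexComb_prod.comp (continuous_const.prodMk (continuous_const.prodMk continuous_id))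

lemma subpath0_eq {Y : Type*} [TopologicalSpace Y] {a b : Y} (γ : Path a b) (t : I) :
    subpath0 γ t = (γ.subpath 0 t).cast γ.source.symm rfl := rfl

lemma sub_left {Y : Type*} [TopologicalSpace Y] {a b c : Y} (P : Path a b) (Q : Path b c) {t : I} (h : t ≤ hlf) :
    (subpath0 (P.trans Q) t).Homotopic ((subpath0 P (dbl t)).cast rfl (trans_left P Q h)) := by
  refine hom_of_factor P _ _ (fun s => dbl (Set.Icc.convexComb 0 t s)) (fun s => Set.Icc.convexComb 0 (dbl t) s)
    (dbl_cont.comp (cont_comb _ _)) (cont_comb _ _) ?_ ?_ ?_ ?_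
  · have : dbl 0 = 0 := Subtype.ext (by simp [dbl])
    simp [this]
  · simp
  · intro s
    have h' : Set.Icc.convexComb 0 t s ≤ hlf := by
      show (1 - s.1) * 0 + s.1 * t.1 ≤ 1 / 2
      have h1 : t.1 ≤ 1/2 := h
      have h2 := s.2.1
      have h3 := s.2.2
      have h4 := t.2.1
      nlinarith
    exact trans_left P Q h'
  · intro s; rfl

def gg (t s : I) : I := ⟨min s.1 (1/2) + (dbl' s).1 * (dbl' t).1 / 2, by
    have h1 := s.2.1
    have h2 := (dbl' s).2.1
    have h3 := (dbl' t).2.1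
    have : 0 ≤ min s.1 (1/2) := le_min h1 (by norm_num)
    positivity, by
    have h2 := (dbl' s).2.1
    have h2' := (dbl' s).2.2
    have h3 := (dbl' t).2.1
    have h3' := (dbl' t).2.2
    have : min s.1 (1/2) ≤ 1/2 := min_le_right _ _
    nlinarith⟩

lemma gg_cont (t : I) : Continuous (gg t) := Continuous.subtype_mk (by
  have := dbl'_cont
  fun_prop) _

lemma sub_right {Y : Type*} [TopologicalSpace Y] {a b c : Y} (P : Path a b) (Q : Path b c) {t : I} (h : hlf ≤ t) :
    (subpath0 (P.trans Q) t).Homotopic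
      ((P.trans (subpath0 Q (dbl' t))).cast rfl (trans_right P Q h)) := by
  have ht : 1/2 ≤ t.1 := h
  have e0 : (dbl' t).1 = 2 * t.1 - 1 := max_eq_right (by linarith)
  refine hom_of_factor (P.trans Q) _ _ (fun s => Set.Icc.convexComb 0 t s) (gg t)
    (cont_comb _ _) (gg_cont t) ?_ ?_ ?_ ?_
  · simp only [Set.Icc.convexComb_zero]
    apply Subtype.ext
    simp [gg, dbl']
  · simp only [Set.Icc.convexComb_one]
    apply Subtype.ext
    have e1 : (dbl' 1).1 = 1 := by norm_num [dbl']
    show t.1 = min 1 (1/2) + (dbl' 1).1 * (dbl' t).1 / 2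
    rw [e0, e1, min_eq_right (by norm_num)]; ring
  · intro s; rfl
  · intro s
    show (P.trans (subpath0 Q (dbl' t))) s = _
    rcases le_total s hlf with hs | hs
    · have hs' : s.1 ≤ 1/2 := hs
      have e : gg t s = s := Subtype.ext (by
        show min s.1 (1/2) + max 0 (2 * s.1 - 1) * (dbl' t).1 / 2 = s.1
        rw [min_eq_left hs', max_eq_left (by linarith)]; ring)
      rw [e, trans_left _ _ hs, trans_left _ _ hs]
    · have hs' : 1/2 ≤ s.1 := hs
      have e1 : (dbl' s).1 = 2 * s.1 - 1 := max_eq_right (by linarith)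
      have e : (gg t s).1 = 1/2 + (dbl' s).1 * (dbl' t).1 / 2 := by
        show min s.1 (1/2) + _ = _
        rw [min_eq_right hs']
      have h2 := (dbl' s).2.1
      have h3 := (dbl' t).2.1
      have h4 := mul_nonneg h2 h3
      have e' : hlf ≤ gg t s := by
        show 1/2 ≤ (gg t s).1
        rw [e]; linarith
      rw [trans_right _ _ hs, trans_right _ _ e']
      show Q _ = _
      refine congrArg Q (Subtype.ext ?_)
      show (1 - (dbl' s).1) * 0 + (dbl' s).1 * (dbl' t).1 = max 0 (2 * (gg t s).1 - 1)
      rw [e, max_eq_right (by linarith)]; ring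

variable {X : Set E2}

lemma hom_cancel {Y : Type*} [TopologicalSpace Y] {a b c : Y} (P : Path a b) (Q : Path a c) :
    (P.trans (P.symm.trans Q)).Homotopic Q :=
  have h : (P.trans P.symm).Homotopic (Path.refl a) := ⟨(Path.Homotopy.reflTransSymm P).symm⟩
  (hom_assoc _ _ _).symm.trans ((h.hcomp (Path.Homotopic.refl Q)).trans (hom_refl_trans Q))

lemma assemble (G : Good X) (xstar : X) {ζ : ℝ} (hζ : 0 ≤ ζ) (N : ℕ) (x : ℕ → X)
    (τ : ∀ i : ℕ, Path xstar (x i)) (hc : ∀ i ≤ N + 1, cost (τ i) ≤ ENNReal.ofReal ζ)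
    (γ : ∀ i : ℕ, Path (x i) (x (i + 1))) (hopt : ∀ i ≤ N, IsOptimal (γ i))
    (hhom : ∀ i ≤ N, (γ i).Homotopic ((τ i).symm.trans (τ (i + 1)))) :
    ∀ n ≤ N + 1, ((τ 0).trans (chain x γ n)).Homotopic (τ n) ∧
      ∀ t, mCost ((τ 0).trans (subpath0 (chain x γ n) t)) ≤ ENNReal.ofReal ζ := by
  intro n
  induction n with
  | zero =>
    intro _
    refine ⟨hom_trans_refl _, fun t => ?_⟩
    refine (mCost_le (Path.Homotopic.refl _)).trans ((cost_trans_le _ _).trans ?_)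
    have h1 : cost (subpath0 (chain x γ 0) t) ≤ 0 := by
      rw [subpath0_eq, cost_cast]
      refine (cost_subpath_le _ unitInterval.nonneg').trans ((eVariationOn.mono _ (subset_univ _)).trans ?_)
      exact (cost_refl (x 0)).le
    calc _ ≤ ENNReal.ofReal ζ + 0 := add_le_add (hc 0 (by omega)) h1
      _ = _ := add_zero _
  | succ n ih =>
    intro hn
    obtain ⟨ih1, ih2⟩ := ih (by omega)
    refine ⟨?_, fun t => ?_⟩
    · show ((τ 0).trans ((chain x γ n).trans (γ n))).Homotopic _
      exact (hom_assoc _ _ _).symm.trans ((ih1.hcomp (hhom n (by omega))).trans (hom_cancel _ _))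
    · show mCost ((τ 0).trans (subpath0 ((chain x γ n).trans (γ n)) t)) ≤ _
      rcases le_total t hlf with h | h
      · refine (mCost_congr ((Path.Homotopic.refl _).hcomp (sub_left _ _ h))).trans ?_
        have := mCost_trans_cast (τ 0) (subpath0 (chain x γ n) (dbl t)) (trans_left (chain x γ n) (γ n) h)
        exact this.le.trans (ih2 _)
      · refine (mCost_congr ((Path.Homotopic.refl _).hcomp (sub_right _ _ h))).trans ?_
        have := mCost_trans_cast (τ 0) ((chain x γ n).trans (subpath0 (γ n) (dbl' t))) (trans_right (chain x γ n) (γ n) h)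
        refine this.le.trans ?_
        refine (mCost_congr ((hom_assoc _ _ _).symm.trans (ih1.hcomp (Path.Homotopic.refl _)))).trans ?_
        exact core G (τ n) (τ (n+1)) (γ n) (hhom n (by omega)) (hopt n (by omega)) hζ (hc n (by omega))
          (hc (n+1) hn) (dbl' t)

lemma visits {Y : Type*} [TopologicalSpace Y] (x : ℕ → Y) (γ : ∀ i : ℕ, Path (x i) (x (i + 1))) (n : ℕ) :
    ∃ t : ℕ → I, Monotone t ∧ t 0 = 0 ∧ t (n+1) = 1 ∧ ∀ i ≤ n + 1, chain x γ (n+1) (t i) = x i := by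
  have hl : dbl hlf = 1 := Subtype.ext (by norm_num [dbl, hlf])
  induction n with
  | zero =>
    refine ⟨fun i => if i = 0 then 0 else 1, ?_, by simp, by simp, ?_⟩
    · intro i j hij
      by_cases hi : i = 0
      · simp [hi]
      · simp [hi, show j ≠ 0 by omega]
    · intro i hi
      rcases (show i = 0 ∨ i = 1 by omega) with rfl | rfl
      · simp
      · simp
  | succ n ih =>
    obtain ⟨t, hm, h0, h1, hv⟩ := ih
    let half : I → I := fun s => ⟨s.1 / 2, by have := s.2.1; positivity, by have := s.2.2; linarith⟩
    have hhalf : ∀ s, half s ≤ hlf := fun s => by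
      show s.1 / 2 ≤ 1 / 2
      have := s.2.2; linarith
    have hdh : ∀ s, dbl (half s) = s := fun s => Subtype.ext (by
      show min 1 (2 * (s.1 / 2)) = s.1
      rw [min_eq_right (by have := s.2.2; linarith)]; ring)
    refine ⟨fun i => if i ≤ n + 1 then half (t i) else 1, ?_, ?_, ?_, ?_⟩
    · intro i j hij
      by_cases hj : j ≤ n + 1
      · have hi : i ≤ n + 1 := by omega
        simp only [hi, hj, if_true]
        show (t i).1 / 2 ≤ (t j).1 / 2
        have : (t i).1 ≤ (t j).1 := hm hij
        linarith
      · simp only [hj, if_false]; exact unitInterval.le_one'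
    · simp only [Nat.zero_le, if_true, h0]
      exact Subtype.ext (by simp [half])
    · simp
    · intro i hi
      by_cases h : i ≤ n + 1
      · simp only [h, if_true]
        show ((chain x γ (n+1)).trans (γ (n+1))) _ = _
        rw [trans_left _ _ (hhalf _), hdh]
        exact hv i h
      · have e : i = n + 1 + 1 := by omega
        subst e
        simp

end

/-- the concatenation `γ = σ₁ * σ₂ * ⋯ * σ_{N+1}` of optimal homotopic
paths with `σ_i ≃_p ς̄*_{i-1} * ς*_i` (all configurations anchored at `x⋆` and of cost
at most ζ, with `ς*_0 = ς*_{N+1} = ς_s`) is a solution of the TMV problem: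
(1) it is a loop at `x_s` visiting `x₁, …, x_N` in order,
(2) `m[ς_s * γ_{[0,t]}] ≤ ζ` for all t,
(3) `ς_s * γ ≃_p ς_s`. -/
theorem tmv_solution {X : Set E2} (hcomp : IsCompact X) (hpc : IsPathConnected X)
    (hpoly : ∃ (n : ℕ) (P : Fin n → Finset E2), X = ⋃ i, convexHull ℝ (↑(P i) : Set E2))
    (xstar : X) {ζ : ℝ} (hζ : 0 ≤ ζ) (N : ℕ)
    (x : ℕ → X) (hxN : x (N + 1) = x 0)
    (ς : ∀ i : ℕ, Path xstar (x i))
    (hςopt : ∀ i ≤ N, IsOptimal (ς i))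
    (hςcost : ∀ i ≤ N, cost (ς i) ≤ ENNReal.ofReal ζ)
    (hςlast : ς (N + 1) = (ς 0).cast rfl hxN)
    (σ : ∀ i : ℕ, Path (x i) (x (i + 1)))
    (hσopt : ∀ i ≤ N, IsOptimal (σ i))
    (hσhom : ∀ i ≤ N, (σ i).Homotopic ((ς i).symm.trans (ς (i + 1)))) :
    (∃ t : ℕ → unitInterval, Monotone t ∧ t 0 = 0 ∧ t (N + 1) = 1 ∧
        ∀ i ≤ N + 1, (chain x σ (N + 1)) (t i) = x i) ∧
    (∀ t : unitInterval,
        mCost ((ς 0).trans (subpath0 (chain x σ (N + 1)) t)) ≤ ENNReal.ofReal ζ) ∧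
    ((ς 0).trans (chain x σ (N + 1))).Homotopic ((ς 0).cast rfl hxN) := by
  have G : Good X := good_of hcomp hpc (fun x => exists_coneAt hpoly x)
  have hc : ∀ i ≤ N + 1, cost (ς i) ≤ ENNReal.ofReal ζ := by
    intro i hi
    rcases Nat.lt_or_ge i (N + 1) with h | h
    · exact hςcost i (by omega)
    · obtain rfl : i = N + 1 := by omega
      rw [hςlast, cost_cast]
      exact hςcost 0 (by omega)
  obtain ⟨h1, h2⟩ := assemble G xstar hζ N x ς hc σ hσopt hσhom (N + 1) le_rfl
  exact ⟨visits x σ N, h2, by rw [← hςlast]; exact h1⟩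

end THPP
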